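/- There are constants b₀, b₁, b₂, b₃ > 0 (with b₂, b₃ absolute, and b₁ depending on λ and Λ) such that for every λ > 0, every Λ < ∞, and every finite connected transitive graph 𝔾 satisfying the triangle condition ∇_{p_c}(x,y) ≤ δ_{x,y} + a₀ with a₀ ≤ b₀ and λV^{1/3} ≥ b₀^{-1}, the following holds: if p = p_c + Ω^{-1}ε with |ε| ≤ ΛV^{-1/3} and if 1 ≤ k ≤ b₁V^{2/3}, then b₂/√k ≤ P_{≥k}(p) ≤ b₃/√k. -/

import Mathlib

noncomputable section
open Classical

namespace Percolation

variable {V : Type*} [Fintype V] [DecidableEq V]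

/-- A percolation configuration: an assignment of occupied (`true`) or
vacant (`false`) to each bond of the graph. -/
def Config (G : SimpleGraph V) : Type _ := G.edgeSet → Bool

noncomputable instance (G : SimpleGraph V) : Fintype G.edgeSet :=
  Fintype.ofFinite _

noncomputable instance (G : SimpleGraph V) : Fintype (Config G) :=
  inferInstanceAs (Fintype (G.edgeSet → Bool))

/-- The probability weight of a configuration under the product Bernoulli
measure with parameter `p`. -/
def weight (G : SimpleGraph V) (p : ℝ) (ω : Config G) : ℝ :=
  ∏ e : G.edgeSet, if ω e then p else 1 - p

/-- The probability of an event under the percolation measure `ℙ_p`. -/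
def prob (G : SimpleGraph V) (p : ℝ) (A : Config G → Prop) : ℝ :=
  ∑ ω : Config G, if A ω then weight G p ω else 0

/-- The expectation of a random variable under the percolation measure `ℙ_p`. -/
def expect (G : SimpleGraph V) (p : ℝ) (f : Config G → ℝ) : ℝ :=
  ∑ ω : Config G, weight G p ω * f ω

/-- The subgraph consisting of the occupied bonds of a configuration. -/
def occupied (G : SimpleGraph V) (ω : Config G) : SimpleGraph V :=
  SimpleGraph.fromEdgeSet {e | ∃ h : e ∈ G.edgeSet, ω ⟨e, h⟩ = true}

/-- The cluster `C(x)` of the vertex `x`: all vertices joined to `x` by a path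
of occupied bonds (including `x` itself). -/
def cluster (G : SimpleGraph V) (ω : Config G) (x : V) : Finset V :=
  Finset.univ.filter fun y => (occupied G ω).Reachable x y

/-- The susceptibility `χ(p)`: the expected size of the cluster of `x₀`. -/
def chi (G : SimpleGraph V) (x₀ : V) (p : ℝ) : ℝ :=
  expect G p fun ω => ((cluster G ω x₀).card : ℝ)

/-- The two-point function `τ_p(x,y) = ℙ_p(x ↔ y)`. -/
def tau (G : SimpleGraph V) (p : ℝ) (x y : V) : ℝ :=
  prob G p fun ω => (occupied G ω).Reachable x y

/-- The triangle diagram `∇_p(x,y)`. -/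
def triangle (G : SimpleGraph V) (p : ℝ) (x y : V) : ℝ :=
  ∑ u : V, ∑ v : V, tau G p x u * tau G p u v * tau G p v y

/-- The Kronecker delta `δ_{x,y}`. -/
def kron (x y : V) : ℝ := if x = y then 1 else 0

/-- `∇̄_p`: the maximum of the triangle diagram over bonds `{x,y} ∈ 𝔹`. -/
def nablaBar (G : SimpleGraph V) (p : ℝ) : ℝ :=
  sSup {t : ℝ | ∃ x y : V, G.Adj x y ∧ t = triangle G p x y}

/-- A graph is (vertex-)transitive if any vertex can be mapped to any other
by a graph automorphism. -/
def IsTransitive (G : SimpleGraph V) : Prop :=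
  ∀ x y : V, ∃ φ : G ≃g G, φ x = y

/-- The size `|C_max|` of the largest cluster. -/
def maxCluster (G : SimpleGraph V) (ω : Config G) : ℕ :=
  Finset.univ.sup fun x => (cluster G ω x).card

/-- The cluster size distribution `P_{≥k}(p) = ℙ_p(|C(x₀)| ≥ k)`. -/
def Pgeq (G : SimpleGraph V) (x₀ : V) (p : ℝ) (k : ℝ) : ℝ :=
  prob G p fun ω => k ≤ ((cluster G ω x₀).card : ℝ)

/-- The magnetization `M(p,γ)`. -/
def magnetization (G : SimpleGraph V) (x₀ : V) (p γ : ℝ) : ℝ :=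
  ∑ k ∈ Finset.Icc 1 (Fintype.card V),
    (1 - (1 - γ) ^ k) * prob G p fun ω => (cluster G ω x₀).card = k

/-- `Z_{≥s}`: the number of vertices lying in clusters of size at least `s`. -/
def Zgeq (G : SimpleGraph V) (s : ℝ) (ω : Config G) : ℝ :=
  ∑ x : V, if s ≤ ((cluster G ω x).card : ℝ) then (1 : ℝ) else 0

/-- The variance of a random variable under `ℙ_p`. -/
def variance (G : SimpleGraph V) (p : ℝ) (f : Config G → ℝ) : ℝ :=
  expect G p (fun ω => f ω ^ 2) - (expect G p f) ^ 2

/-- The restricted susceptibility `χ_{≥s}(p) = 𝔼_p[|C(x₀)| I[|C(x₀)| ≥ s]]`. -/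
def chiGeq (G : SimpleGraph V) (x₀ : V) (p : ℝ) (s : ℝ) : ℝ :=
  expect G p fun ω =>
    if s ≤ ((cluster G ω x₀).card : ℝ) then ((cluster G ω x₀).card : ℝ) else 0

/-- The restricted susceptibility `χ_{<s}(p) = 𝔼_p[|C(x₀)| I[|C(x₀)| < s]]`. -/
def chiLt (G : SimpleGraph V) (x₀ : V) (p : ℝ) (s : ℝ) : ℝ :=
  expect G p fun ω =>
    if ((cluster G ω x₀).card : ℝ) < s then ((cluster G ω x₀).card : ℝ) else 0

end Percolation

set_option linter.unusedSectionVars false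
set_option linter.unusedVariables false

namespace Perc

/-- Indicator of a proposition. -/
def ind (P : Prop) : ℝ := if P then 1 else 0

lemma ind_pos {P : Prop} (h : P) : ind P = 1 := by simp [ind, h]
lemma ind_neg {P : Prop} (h : ¬ P) : ind P = 0 := by simp [ind, h]
lemma ind_nonneg (P : Prop) : 0 ≤ ind P := by unfold ind; split_ifs <;> norm_num
lemma ind_le_one (P : Prop) : ind P ≤ 1 := by unfold ind; split_ifs <;> norm_num
lemma ind_mono {P Q : Prop} (h : P → Q) : ind P ≤ ind Q := by
  by_cases hp : P
  · rw [ind_pos hp, ind_pos (h hp)]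
  · rw [ind_neg hp]; exact ind_nonneg Q
lemma ind_and (P Q : Prop) : ind (P ∧ Q) = ind P * ind Q := by
  unfold ind; split_ifs <;> simp_all
lemma ind_not (P : Prop) : ind (¬ P) = 1 - ind P := by
  unfold ind; split_ifs <;> simp_all
lemma ind_congr {P Q : Prop} (h : P ↔ Q) : ind P = ind Q := by rw [propext h]

section prob
variable {ι : Type*} [DecidableEq ι]

/-- Expectation over Bernoulli(`p`) random subsets of `s`. -/
def E (p : ℝ) (s : Finset ι) (F : Finset ι → ℝ) : ℝ :=
  ∑ S ∈ s.powerset, p ^ S.card * (1 - p) ^ (s \ S).card * F S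

variable {p : ℝ} {s : Finset ι}

lemma E_empty (p : ℝ) (F : Finset ι → ℝ) : E p ∅ F = F ∅ := by simp [E]

lemma E_insert (p : ℝ) {e : ι} {s : Finset ι} (he : e ∉ s) (F : Finset ι → ℝ) :
    E p (insert e s) F = (1 - p) * E p s F + p * E p s (fun S => F (insert e S)) := by
  unfold E
  rw [Finset.sum_powerset_insert he, Finset.mul_sum, Finset.mul_sum]
  congr 1
  · refine Finset.sum_congr rfl fun S hS => ?_
    have hS' := Finset.mem_powerset.1 hS
    have h1 : insert e s \ S = insert e (s \ S) :=
      Finset.insert_sdiff_of_notMem _ (fun h => he (hS' h))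
    rw [h1, Finset.card_insert_of_notMem (by simp [he])]
    ring
  · refine Finset.sum_congr rfl fun S hS => ?_
    have hS' := Finset.mem_powerset.1 hS
    have h1 : insert e s \ insert e S = s \ S := by
      ext i; simp only [Finset.mem_sdiff, Finset.mem_insert]
      constructor
      · tauto
      · rintro ⟨h, h'⟩
        refine ⟨Or.inr h, ?_⟩
        rintro (rfl | h2)
        · exact he h
        · exact h' h2
    rw [h1, Finset.card_insert_of_notMem (fun h => he (hS' h))]
    ring

lemma E_congr {F F' : Finset ι → ℝ} (h : ∀ S, S ⊆ s → F S = F' S) : E p s F = E p s F' :=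
  Finset.sum_congr rfl fun S hS => by rw [h S (Finset.mem_powerset.1 hS)]

lemma E_mono (hp0 : 0 ≤ p) (hp1 : p ≤ 1) {F F' : Finset ι → ℝ} (h : ∀ S, S ⊆ s → F S ≤ F' S) :
    E p s F ≤ E p s F' :=
  Finset.sum_le_sum fun S hS => by
    have := h S (Finset.mem_powerset.1 hS)
    have h1 : 0 ≤ 1 - p := by linarith
    gcongr

lemma E_add (F F' : Finset ι → ℝ) : E p s (fun S => F S + F' S) = E p s F + E p s F' := by
  simp [E, mul_add, Finset.sum_add_distrib]

lemma E_sub (F F' : Finset ι → ℝ) : E p s (fun S => F S - F' S) = E p s F - E p s F' := by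
  simp [E, mul_sub, Finset.sum_sub_distrib]

lemma E_mul (c : ℝ) (F : Finset ι → ℝ) : E p s (fun S => c * F S) = c * E p s F := by
  simp only [E, Finset.mul_sum]
  exact Finset.sum_congr rfl fun S _ => by ring

lemma E_mul_right (c : ℝ) (F : Finset ι → ℝ) : E p s (fun S => F S * c) = E p s F * c := by
  simp only [E, Finset.sum_mul]
  exact Finset.sum_congr rfl fun S _ => by ring

lemma E_sum {κ : Type*} (t : Finset κ) (F : κ → Finset ι → ℝ) :
    E p s (fun S => ∑ k ∈ t, F k S) = ∑ k ∈ t, E p s (F k) := by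
  simp only [E, Finset.mul_sum]
  rw [Finset.sum_comm]

lemma E_comm {κ : Type*} [DecidableEq κ] {h : ℝ} {t : Finset κ} (F : Finset ι → Finset κ → ℝ) :
    E p s (fun S => E h t (fun g => F S g)) = E h t (fun g => E p s (fun S => F S g)) := by
  unfold E
  simp only [Finset.mul_sum]
  rw [Finset.sum_comm]
  refine Finset.sum_congr rfl fun S _ => Finset.sum_congr rfl fun T _ => by ring

lemma E_const (p : ℝ) (s : Finset ι) (c : ℝ) : E p s (fun _ => c) = c := by
  induction s using Finset.induction_on with
  | empty => rw [E_empty]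
  | insert e s he ih => rw [E_insert p he, ih]; ring

lemma E_nonneg (hp0 : 0 ≤ p) (hp1 : p ≤ 1) {F : Finset ι → ℝ} (h : ∀ S, S ⊆ s → 0 ≤ F S) :
    0 ≤ E p s F := by
  rw [← E_const p s 0]; exact E_mono hp0 hp1 h

lemma E_indep (p : ℝ) (s : Finset ι) (T : ι → Prop) : ∀ (X Y : Finset ι → ℝ),
    E p s (fun S => X (S.filter T) * Y (S.filter fun i => ¬ T i)) =
      E p s (fun S => X (S.filter T)) * E p s (fun S => Y (S.filter fun i => ¬ T i)) := by
  induction s using Finset.induction_on with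
  | empty => intro X Y; simp [E_empty]
  | insert e s he ih =>
    intro X Y
    rw [E_insert p he, E_insert p he, E_insert p he]
    by_cases hT : T e
    · simp only [Finset.filter_insert, hT, if_true, not_true_eq_false, if_false]
      rw [ih X Y, ih (fun S => X (insert e S)) Y]
      ring
    · simp only [Finset.filter_insert, hT, if_true, not_false_eq_true, if_false]
      rw [ih X Y, ih X (fun S => Y (insert e S))]
      ring

lemma E_restrict (p : ℝ) (s : Finset ι) (T : ι → Prop) : ∀ (X : Finset ι → ℝ),
    E p s (fun S => X (S.filter T)) = E p (s.filter T) X := by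
  induction s using Finset.induction_on with
  | empty => intro X; simp [E_empty]
  | insert e s he ih =>
    intro X
    rw [E_insert p he]
    by_cases hT : T e
    · simp only [Finset.filter_insert, hT, if_true]
      rw [E_insert p (by simp [he]), ih X, ih (fun S => X (insert e S))]
    · simp only [Finset.filter_insert, hT, if_false]
      rw [ih X]; ring

/-- Opening a closed bond. -/
lemma E_open (p : ℝ) {s : Finset ι} {e : ι} (he : e ∈ s) (F : Finset ι → ℝ) :
    p * E p s (fun S => ind (e ∉ S) * F S) =
      (1 - p) * E p s (fun S => ind (e ∈ S) * F (S.erase e)) := by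
  obtain ⟨s, hs, rfl⟩ : ∃ s', e ∉ s' ∧ s = insert e s' :=
    ⟨s.erase e, by simp, by simp [Finset.insert_erase he]⟩
  rw [E_insert p hs, E_insert p hs]
  have h1 : E p s (fun S => ind (e ∉ S) * F S) = E p s F :=
    E_congr fun S hS => by rw [ind_pos (fun h => hs (hS h))]; ring
  have h2 : E p s (fun S => ind (e ∈ S) * F (S.erase e)) = 0 := by
    rw [← E_const p s 0]
    exact E_congr fun S hS => by rw [ind_neg (fun h => hs (hS h))]; ring
  have h3 : E p s (fun S => ind (e ∉ insert e S) * F (insert e S)) = 0 := by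
    rw [← E_const p s 0]
    exact E_congr fun S hS => by rw [ind_neg (by simp)]; ring
  have h4 : E p s (fun S => ind (e ∈ insert e S) * F ((insert e S).erase e)) = E p s F :=
    E_congr fun S hS => by
      rw [ind_pos (by simp), Finset.erase_insert (fun h => hs (hS h))]; ring
  rw [h1, h2, h3, h4]; ring

/-- Russo's formula. -/
lemma E_deriv (s : Finset ι) : ∀ (F : Finset ι → ℝ) (p : ℝ),
    HasDerivAt (fun p => E p s F)
      (∑ e ∈ s, E p s (fun S => F (insert e S) - F (S.erase e))) p := by
  induction s using Finset.induction_on with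
  | empty =>
    intro F p
    simp only [E_empty, Finset.sum_empty]
    exact hasDerivAt_const _ _
  | insert e s he ih =>
    intro F p
    have h1 := ((hasDerivAt_id p).const_sub 1).mul (ih F p)
    have h2 := (hasDerivAt_id p).mul (ih (fun S => F (insert e S)) p)
    have h3 := h1.add h2
    have h4 : (fun p => E p (insert e s) F) =
        ((fun x => 1 - id x) * fun p => E p s F) +
          (id * fun p => E p s fun S => F (insert e S)) := by
      funext q; rw [E_insert q he]; rfl
    rw [h4]
    refine h3.congr_deriv (Eq.symm ?_)
    rw [Finset.sum_insert he, E_insert p he]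
    have h5 : E p s (fun S => F (insert e S) - F (S.erase e)) =
        E p s (fun S => F (insert e S)) - E p s F := by
      rw [← E_sub]
      exact E_congr fun S hS => by rw [Finset.erase_eq_of_notMem (fun h => he (hS h))]
    have h6 : E p s (fun S => F (insert e (insert e S)) - F ((insert e S).erase e)) =
        E p s (fun S => F (insert e S)) - E p s F := by
      rw [← E_sub]
      exact E_congr fun S hS => by
        rw [Finset.erase_insert (fun h => he (hS h)), Finset.insert_idem]
    have h7 : ∑ i ∈ s, E p (insert e s) (fun S => F (insert i S) - F (S.erase i)) =
        (1 - p) * ∑ i ∈ s, E p s (fun S => F (insert i S) - F (S.erase i)) +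
        p * ∑ i ∈ s, E p s (fun S => F (insert e (insert i S)) - F (insert e (S.erase i))) := by
      rw [Finset.mul_sum, Finset.mul_sum, ← Finset.sum_add_distrib]
      refine Finset.sum_congr rfl fun i hi => ?_
      have hne : e ≠ i := fun h => he (h ▸ hi)
      rw [E_insert p he]
      congr 2
      refine E_congr fun S hS => ?_
      rw [Finset.insert_comm, Finset.erase_insert_of_ne hne]
    rw [h5, h6, h7]
    simp only [id]
    ring

/-- Russo's formula, in the form with closed bonds. -/
lemma E_closed (p : ℝ) {s : Finset ι} {e : ι} (he : e ∈ s) (F : Finset ι → ℝ) :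
    (1 - p) * E p s (fun S => F (insert e S) - F (S.erase e)) =
      E p s (fun S => ind (e ∉ S) * (F (insert e S) - F S)) := by
  obtain ⟨s, hs, rfl⟩ : ∃ s', e ∉ s' ∧ s = insert e s' :=
    ⟨s.erase e, by simp, by simp [Finset.insert_erase he]⟩
  rw [E_insert p hs, E_insert p hs]
  have h5 : E p s (fun S => F (insert e S) - F (S.erase e)) =
      E p s (fun S => F (insert e S)) - E p s F := by
    rw [← E_sub]
    exact E_congr fun S hS => by rw [Finset.erase_eq_of_notMem (fun h => hs (hS h))]
  have h6 : E p s (fun S => F (insert e (insert e S)) - F ((insert e S).erase e)) =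
      E p s (fun S => F (insert e S)) - E p s F := by
    rw [← E_sub]
    exact E_congr fun S hS => by
      rw [Finset.erase_insert (fun h => hs (hS h)), Finset.insert_idem]
  have h1 : E p s (fun S => ind (e ∉ S) * (F (insert e S) - F S)) =
      E p s (fun S => F (insert e S)) - E p s F := by
    rw [← E_sub]
    exact E_congr fun S hS => by rw [ind_pos (fun h => hs (hS h))]; ring
  have h3 : E p s (fun S => ind (e ∉ insert e S) * (F (insert e (insert e S)) - F (insert e S)))
      = 0 := by
    rw [← E_const p s 0]
    exact E_congr fun S hS => by rw [ind_neg (by simp)]; ring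
  rw [h5, h6, h1, h3]; ring

/-- Disjoint occurrence. -/
def Dis (A B : Finset ι → Prop) (S : Finset ι) : Prop :=
  ∃ S₁ S₂, S₁ ⊆ S ∧ S₂ ⊆ S ∧ Disjoint S₁ S₂ ∧ A S₁ ∧ B S₂

/-- Increasing event. -/
def Inc (A : Finset ι → Prop) : Prop := ∀ S T, S ⊆ T → A S → A T

lemma Dis_inc (A B : Finset ι → Prop) : Inc (Dis A B) := by
  rintro S T h ⟨S₁, S₂, h1, h2, h3⟩
  exact ⟨S₁, S₂, h1.trans h, h2.trans h, h3⟩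

lemma Dis_mono {A B A' B' : Finset ι → Prop} (hA : ∀ S, A S → A' S) (hB : ∀ S, B S → B' S)
    {S : Finset ι} : Dis A B S → Dis A' B' S := by
  rintro ⟨S₁, S₂, h1, h2, h3, h4, h5⟩
  exact ⟨S₁, S₂, h1, h2, h3, hA _ h4, hB _ h5⟩

/-- The van den Berg--Kesten inequality (for `p ≤ 1/2`). -/
lemma BK (hp0 : 0 ≤ p) (hp1 : p ≤ 1 / 2) (s : Finset ι) : ∀ (A B : Finset ι → Prop),
    Inc A → Inc B →
    E p s (fun S => ind (Dis A B S)) ≤ E p s (fun S => ind (A S)) * E p s (fun S => ind (B S)) := by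
  induction s using Finset.induction_on with
  | empty =>
    intro A B hA hB
    simp only [E_empty]
    rw [← ind_and]
    apply ind_mono
    rintro ⟨S₁, S₂, h1, h2, h3, h4, h5⟩
    exact ⟨hA _ _ h1 h4, hB _ _ h2 h5⟩
  | insert e s he ih =>
    intro A B hA hB
    have hA1 : Inc (fun S => A (insert e S)) := fun S T h hS =>
      hA _ _ (Finset.insert_subset_insert _ h) hS
    have hB1 : Inc (fun S => B (insert e S)) := fun S T h hS =>
      hB _ _ (Finset.insert_subset_insert _ h) hS
    have hAA : ∀ S, A S → A (insert e S) := fun S h => hA _ _ (Finset.subset_insert _ _) h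
    have hBB : ∀ S, B S → B (insert e S) := fun S h => hB _ _ (Finset.subset_insert _ _) h
    rw [E_insert p he, E_insert p he, E_insert p he]
    have i00 := ih A B hA hB
    have i10 := ih _ B hA1 hB
    have i01 := ih A _ hA hB1
    have key : E p s (fun S => ind (Dis A B (insert e S))) ≤
        E p s (fun S => ind (Dis (fun S => A (insert e S)) B S)) +
        E p s (fun S => ind (Dis A (fun S => B (insert e S)) S)) -
        E p s (fun S => ind (Dis A B S)) := by
      rw [← E_add, ← E_sub]
      refine E_mono hp0 (by linarith) fun S hS => ?_
      have heS : e ∉ S := fun h => he (hS h)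
      have imp : Dis A B (insert e S) →
          Dis (fun S => A (insert e S)) B S ∨ Dis A (fun S => B (insert e S)) S := by
        rintro ⟨S₁, S₂, h1, h2, h3, h4, h5⟩
        by_cases h : e ∈ S₁
        · left
          have h' : e ∉ S₂ := Finset.disjoint_left.1 h3 h
          refine ⟨S₁.erase e, S₂, ?_, ?_, ?_, ?_, h5⟩
          · rwa [← Finset.subset_insert_iff]
          · rwa [← Finset.subset_insert_iff_of_notMem h']
          · exact Finset.disjoint_of_subset_left (Finset.erase_subset _ _) h3
          · show A (insert e (S₁.erase e))
            rwa [Finset.insert_erase h]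
        · right
          refine ⟨S₁, S₂.erase e, ?_, ?_, ?_, h4, ?_⟩
          · rwa [← Finset.subset_insert_iff_of_notMem h]
          · rwa [← Finset.subset_insert_iff]
          · exact Finset.disjoint_of_subset_right (Finset.erase_subset _ _) h3
          · refine hB _ _ ?_ h5
            exact Finset.insert_erase_subset e S₂
      have m1 : Dis A B S → Dis (fun S => A (insert e S)) B S := Dis_mono hAA (fun _ h => h)
      have m2 : Dis A B S → Dis A (fun S => B (insert e S)) S := Dis_mono (fun _ h => h) hBB
      by_cases h0 : Dis A B S
      · rw [ind_pos h0, ind_pos (m1 h0), ind_pos (m2 h0)]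
        have := ind_le_one (Dis A B (insert e S)); linarith
      · rw [ind_neg h0]
        by_cases h1 : Dis A B (insert e S)
        · rw [ind_pos h1]
          rcases imp h1 with h | h
          · rw [ind_pos h]
            have := ind_nonneg (Dis A (fun S => B (insert e S)) S); linarith
          · rw [ind_pos h]
            have := ind_nonneg (Dis (fun S => A (insert e S)) B S); linarith
        · rw [ind_neg h1]
          have := ind_nonneg (Dis A (fun S => B (insert e S)) S)
          have := ind_nonneg (Dis (fun S => A (insert e S)) B S); linarith
    have a01 : E p s (fun S => ind (A S)) ≤ E p s (fun S => ind (A (insert e S))) :=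
      E_mono hp0 (by linarith) fun S _ => ind_mono (hAA S)
    have b01 : E p s (fun S => ind (B S)) ≤ E p s (fun S => ind (B (insert e S))) :=
      E_mono hp0 (by linarith) fun S _ => ind_mono (hBB S)
    set a0 := E p s (fun S => ind (A S))
    set a1 := E p s (fun S => ind (A (insert e S)))
    set b0 := E p s (fun S => ind (B S))
    set b1 := E p s (fun S => ind (B (insert e S)))
    set d00 := E p s (fun S => ind (Dis A B S))
    set d := E p s (fun S => ind (Dis A B (insert e S)))
    have k1 : p * d ≤ p * (a1 * b0 + a0 * b1 - d00) := by
      apply mul_le_mul_of_nonneg_left _ hp0; linarith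
    have k2 : (1 - 2 * p) * d00 ≤ (1 - 2 * p) * (a0 * b0) :=
      mul_le_mul_of_nonneg_left i00 (by linarith)
    have k3 : 0 ≤ p ^ 2 * ((a1 - a0) * (b1 - b0)) :=
      mul_nonneg (sq_nonneg _) (mul_nonneg (by linarith) (by linarith))
    nlinarith

lemma E_perm {ι : Type*} [DecidableEq ι] (p : ℝ) (s : Finset ι) (σ : Equiv.Perm ι)
    (hs : s.map σ.toEmbedding = s) (F : Finset ι → ℝ) :
    E p s (fun S => F (S.map σ.toEmbedding)) = E p s F := by
  unfold E
  refine Finset.sum_bij' (fun S _ => S.map σ.toEmbedding) (fun S _ => S.map σ.symm.toEmbedding)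
    ?_ ?_ ?_ ?_ ?_
  · intro S hS
    rw [Finset.mem_powerset] at hS ⊢
    rw [← hs]; exact Finset.map_subset_map.2 hS
  · intro S hS
    rw [Finset.mem_powerset] at hS ⊢
    have : S ⊆ s.map σ.toEmbedding := by rwa [hs]
    intro x hx
    simp only [Finset.mem_map_equiv, Equiv.symm_symm] at hx
    have := this hx
    simpa [Finset.mem_map_equiv] using this
  · intro S _; ext x; simp [Finset.mem_map_equiv]
  · intro S _; ext x; simp [Finset.mem_map_equiv]
  · intro S hS
    have h1 : (s \ S).card = (s \ S.map σ.toEmbedding).card := by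
      conv_rhs => rw [← hs]
      rw [← Finset.map_sdiff, Finset.card_map]
    simp only [Finset.card_map]
    rw [h1]

/-- Probability that a random set misses a given set. -/
lemma E_miss (p : ℝ) (s : Finset ι) : ∀ (A : Finset ι), A ⊆ s →
    E p s (fun g => ind (Disjoint A g)) = (1 - p) ^ A.card := by
  induction s using Finset.induction_on with
  | empty =>
    intro A hA
    have := Finset.subset_empty.1 hA
    subst this
    simp [E_empty, ind]
  | insert e s he ih =>
    intro A hA
    rw [E_insert p he]
    by_cases h : e ∈ A
    · have h1 : E p s (fun S => ind (Disjoint A (insert e S))) = 0 := by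
        rw [← E_const p s 0]
        refine E_congr fun S _ => ind_neg fun hd => ?_
        exact Finset.disjoint_left.1 hd h (Finset.mem_insert_self _ _)
      have h2 : E p s (fun S => ind (Disjoint A S)) = E p s (fun S => ind (Disjoint (A.erase e) S)) := by
        refine E_congr fun S hS => ind_congr ?_
        rw [Finset.disjoint_left, Finset.disjoint_left]
        constructor
        · intro h x hx; exact h (Finset.mem_of_mem_erase hx)
        · intro h' x hx hxS
          by_cases hxe : x = e
          · subst hxe; exact he (hS hxS)
          · exact h' (Finset.mem_erase.2 ⟨hxe, hx⟩) hxS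
      rw [h1, h2, ih _ (by rwa [← Finset.subset_insert_iff])]
      rw [← Finset.card_erase_add_one h, pow_succ]; ring
    · have h1 : E p s (fun S => ind (Disjoint A (insert e S))) =
          E p s (fun S => ind (Disjoint A S)) := by
        refine E_congr fun S _ => ind_congr ?_
        rw [Finset.disjoint_insert_right]; tauto
      rw [h1, ih A (by rwa [← Finset.subset_insert_iff_of_notMem h])]; ring

end prob
end Perc

namespace Perc
section graph
variable {V : Type*} [Fintype V] [DecidableEq V]

/-- The graph of occupied bonds. -/
def H (S : Finset (Sym2 V)) : SimpleGraph V := SimpleGraph.fromEdgeSet (S : Set (Sym2 V))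

/-- Connection by occupied bonds. -/
def R (S : Finset (Sym2 V)) (x y : V) : Prop := (H S).Reachable x y

/-- Connection to a set. -/
def RG (S : Finset (Sym2 V)) (x : V) (g : Finset V) : Prop := ∃ v ∈ g, R S x v

/-- The cluster of a vertex. -/
def K (S : Finset (Sym2 V)) (x : V) : Finset V := Finset.univ.filter fun y => R S x y

/-- The cluster of a set. -/
def Cl (S : Finset (Sym2 V)) (g : Finset V) : Finset V := Finset.univ.filter fun y => RG S y g

/-- A bond not touching `A`. -/
def offE (A : Finset V) (e : Sym2 V) : Prop := ∀ v ∈ A, v ∉ e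

/-- The bonds of `S` not touching `A`. -/
def off (S : Finset (Sym2 V)) (A : Finset V) : Finset (Sym2 V) := S.filter (offE A)

lemma off_subset (S : Finset (Sym2 V)) (A : Finset V) : off S A ⊆ S := Finset.filter_subset _ _

lemma H_adj {S : Finset (Sym2 V)} {u v : V} : (H S).Adj u v ↔ s(u, v) ∈ S ∧ u ≠ v := by
  simp [H]

lemma R_refl (S : Finset (Sym2 V)) (x : V) : R S x x := SimpleGraph.Reachable.refl _
lemma R_symm {S : Finset (Sym2 V)} {x y : V} (h : R S x y) : R S y x := SimpleGraph.Reachable.symm h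
lemma R_comm {S : Finset (Sym2 V)} {x y : V} : R S x y ↔ R S y x := ⟨R_symm, R_symm⟩
lemma R_trans {S : Finset (Sym2 V)} {x y z : V} (h : R S x y) (h' : R S y z) : R S x z :=
  SimpleGraph.Reachable.trans h h'
lemma R_edge {S : Finset (Sym2 V)} {x y : V} (h : s(x, y) ∈ S) : R S x y := by
  by_cases hxy : x = y
  · subst hxy; exact R_refl _ _
  · exact (H_adj.2 ⟨h, hxy⟩).reachable
lemma R_mono {S T : Finset (Sym2 V)} (hST : S ⊆ T) {x y : V} (h : R S x y) : R T x y :=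
  SimpleGraph.Reachable.mono (fun _ _ huv => H_adj.2 ⟨hST (H_adj.1 huv).1, (H_adj.1 huv).2⟩) h

/-- Induction along an occupied path. -/
lemma R_induct {S : Finset (Sym2 V)} {y : V} {P : V → Prop} (h0 : P y)
    (h1 : ∀ a b, s(a, b) ∈ S → a ≠ b → R S b y → P b → P a) {x : V} (h : R S x y) : P x := by
  obtain ⟨w⟩ := h
  induction w with
  | nil => exact h0
  | cons hab w ih =>
    have := H_adj.1 hab
    exact h1 _ _ this.1 this.2 ⟨w⟩ (ih h0 h1)

lemma RG_mono {S T : Finset (Sym2 V)} (hST : S ⊆ T) {x : V} {g : Finset V} (h : RG S x g) :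
    RG T x g := by
  obtain ⟨v, hv, h⟩ := h; exact ⟨v, hv, R_mono hST h⟩

lemma RG_of_R {S : Finset (Sym2 V)} {x y : V} {g : Finset V} (h : R S x y) (h' : RG S y g) :
    RG S x g := by
  obtain ⟨v, hv, h'⟩ := h'; exact ⟨v, hv, R_trans h h'⟩

lemma RG_singleton {S : Finset (Sym2 V)} {x y : V} : RG S x {y} ↔ R S x y := by simp [RG]

lemma R_inc (x y : V) : Inc (fun S : Finset (Sym2 V) => R S x y) := fun _ _ h h' => R_mono h h'
lemma RG_inc (x : V) (g : Finset V) : Inc (fun S : Finset (Sym2 V) => RG S x g) :=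
  fun _ _ h h' => RG_mono h h'

lemma mem_K {S : Finset (Sym2 V)} {x y : V} : y ∈ K S x ↔ R S x y := by simp [K]
lemma mem_Cl {S : Finset (Sym2 V)} {g : Finset V} {y : V} : y ∈ Cl S g ↔ RG S y g := by simp [Cl]

lemma K_eq_Cl (S : Finset (Sym2 V)) (x : V) : K S x = Cl S {x} := by
  ext y; rw [mem_K, mem_Cl, RG_singleton, R_comm]

lemma K_mono {S T : Finset (Sym2 V)} (h : S ⊆ T) (x : V) : K S x ⊆ K T x := by
  intro y; rw [mem_K, mem_K]; exact R_mono h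

lemma RG_iff_K {S : Finset (Sym2 V)} {x : V} {g : Finset V} : RG S x g ↔ ¬ Disjoint (K S x) g := by
  rw [Finset.not_disjoint_iff]
  simp only [mem_K, RG]
  exact ⟨fun ⟨v, h, h'⟩ => ⟨v, h', h⟩, fun ⟨v, h, h'⟩ => ⟨v, h', h⟩⟩

lemma K_eq_of_R {S : Finset (Sym2 V)} {x y : V} (h : R S x y) : K S x = K S y := by
  ext z; rw [mem_K, mem_K]; exact ⟨fun h' => R_trans (R_symm h) h', fun h' => R_trans h h'⟩

lemma Cl_touch (S : Finset (Sym2 V)) (g A : Finset V) :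
    Cl S g = A ↔ Cl (S.filter fun e => ¬ offE A e) g = A := by
  have hsub : (S.filter fun e => ¬ offE A e) ⊆ S := Finset.filter_subset _ _
  constructor
  · intro h
    rw [← h]
    rw [h]
    rw [← h]
    ext y
    rw [mem_Cl, mem_Cl]
    refine ⟨fun hy => RG_mono (Finset.filter_subset _ _) hy, ?_⟩
    rintro ⟨v, hv, hy⟩
    refine ⟨v, hv, ?_⟩
    refine R_induct (P := fun y => R (S.filter fun e => ¬ offE (Cl S g) e) y v) (R_refl _ _) ?_ hy
    intro a b hab _ hb ih
    refine R_trans (R_edge ?_) ih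
    rw [Finset.mem_filter]
    refine ⟨hab, fun ho => ho b ?_ (by simp)⟩
    rw [mem_Cl]; exact ⟨v, hv, hb⟩
  · intro h
    ext y
    rw [mem_Cl]
    constructor
    · rintro ⟨v, hv, hy⟩
      refine R_induct (P := fun y => y ∈ A) ?_ ?_ hy
      · rw [← h, mem_Cl]; exact ⟨v, hv, R_refl _ _⟩
      · intro a b hab _ _ hb
        have hb' := hb
        rw [← h, mem_Cl] at hb' ⊢
        refine RG_of_R (R_edge ?_) hb'
        rw [Finset.mem_filter]
        exact ⟨hab, fun ho => ho b hb (by simp)⟩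
    · intro hy
      rw [← h, mem_Cl] at hy
      exact RG_mono (Finset.filter_subset _ _) hy

lemma R_off {S : Finset (Sym2 V)} {g : Finset V} {y : V} (hy : y ∉ Cl S g) (z : V) :
    R (off S (Cl S g)) y z ↔ R S y z := by
  refine ⟨R_mono (off_subset _ _), fun h => ?_⟩
  rw [R_comm] at h ⊢
  have : R (off S (Cl S g)) z y ∧ z ∉ Cl S g := by
    refine R_induct (P := fun z => R (off S (Cl S g)) z y ∧ z ∉ Cl S g) ⟨R_refl _ _, hy⟩ ?_ h
    intro a b hab _ _ ih
    have ha : a ∉ Cl S g := by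
      intro ha
      apply ih.2
      rw [mem_Cl] at ha ⊢
      exact RG_of_R (R_symm (R_edge hab)) ha
    refine ⟨R_trans (R_edge ?_) ih.1, ha⟩
    rw [off, Finset.mem_filter]
    refine ⟨hab, fun v hv hve => ?_⟩
    rcases Sym2.mem_iff.1 hve with rfl | rfl
    · exact ha hv
    · exact ih.2 hv
  exact this.1

lemma K_off {S : Finset (Sym2 V)} {g : Finset V} {y : V} (hy : y ∉ Cl S g) :
    K (off S (Cl S g)) y = K S y := by
  ext z; rw [mem_K, mem_K, R_off hy]

lemma R_off_of_mem {S : Finset (Sym2 V)} {A : Finset V} {y z : V} (hy : y ∈ A)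
    (h : R (off S A) z y) : z = y := by
  refine R_induct (P := fun z => z = y) rfl ?_ h
  rintro a b hab _ _ rfl
  rw [off, Finset.mem_filter] at hab
  exact absurd (by simp) (hab.2 b hy)

/-- Exploration of the cluster of a set. -/
lemma explore (p : ℝ) (s : Finset (Sym2 V)) (g : Finset V)
    (Φ : Finset V → Finset (Sym2 V) → ℝ) :
    E p s (fun S => Φ (Cl S g) (off S (Cl S g))) =
      E p s (fun S => (fun A => E p s (fun S' => Φ A (off S' A))) (Cl S g)) := by
  have h1 : ∀ Ψ : Finset V → Finset (Sym2 V) → ℝ,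
      E p s (fun S => Ψ (Cl S g) S) = ∑ A, E p s (fun S => ind (Cl S g = A) * Ψ A S) := by
    intro Ψ
    rw [← E_sum]
    refine E_congr fun S _ => ?_
    rw [Finset.sum_eq_single (Cl S g)]
    · rw [ind_pos rfl, one_mul]
    · intro A _ hA; rw [ind_neg (fun h => hA h.symm), zero_mul]
    · intro h; exact absurd (Finset.mem_univ _) h
  rw [h1 (fun A S => Φ A (off S A)), h1 (fun A _ => E p s (fun S' => Φ A (off S' A)))]
  refine Finset.sum_congr rfl fun A _ => ?_
  rw [E_mul_right]
  have h2 : ∀ S, ind (Cl S g = A) = ind (Cl (S.filter fun e => ¬ offE A e) g = A) := fun S =>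
    ind_congr (Cl_touch S g A)
  have h3 := E_indep p s (offE A) (fun S => Φ A S)
    (fun S => ind (Cl S g = A))
  have h4 : E p s (fun S => ind (Cl S g = A)) =
      E p s (fun S => ind (Cl (S.filter fun e => ¬ offE A e) g = A)) := E_congr fun S _ => h2 S
  rw [h4, mul_comm]
  refine Eq.trans (E_congr fun S _ => ?_) h3
  rw [h2 S, mul_comm]
  rfl

lemma explore_le {p : ℝ} (hp0 : 0 ≤ p) (hp1 : p ≤ 1) (s : Finset (Sym2 V)) (g : Finset V)
    (Φ : Finset V → Finset (Sym2 V) → ℝ) (ψ : Finset V → ℝ)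
    (h : ∀ A, E p s (fun S' => Φ A (off S' A)) ≤ ψ A) :
    E p s (fun S => Φ (Cl S g) (off S (Cl S g))) ≤ E p s (fun S => ψ (Cl S g)) := by
  rw [explore]; exact E_mono hp0 hp1 fun S _ => h _

lemma explore_ge {p : ℝ} (hp0 : 0 ≤ p) (hp1 : p ≤ 1) (s : Finset (Sym2 V)) (g : Finset V)
    (Φ : Finset V → Finset (Sym2 V) → ℝ) (ψ : Finset V → ℝ)
    (h : ∀ A, ψ A ≤ E p s (fun S' => Φ A (off S' A))) :
    E p s (fun S => ψ (Cl S g)) ≤ E p s (fun S => Φ (Cl S g) (off S (Cl S g))) := by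
  rw [explore]; exact E_mono hp0 hp1 fun S _ => h _

end graph
end Perc

namespace Perc
section treegraph
variable {V : Type*} [Fintype V] [DecidableEq V]

lemma walk_subset {S : Finset (Sym2 V)} {a b : V} (w : (H S).Walk a b) :
    w.edges.toFinset ⊆ S := by
  intro e he
  have := w.edges_subset_edgeSet (List.mem_toFinset.1 he)
  rw [H, SimpleGraph.edgeSet_fromEdgeSet] at this
  exact this.1

lemma walk_R {S T : Finset (Sym2 V)} {a b : V} (w : (H S).Walk a b) (h : w.edges.toFinset ⊆ T) :
    R T a b := by
  refine ⟨w.transfer (H T) ?_⟩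
  intro e he
  have h1 := w.edges_subset_edgeSet he
  rw [H, SimpleGraph.edgeSet_fromEdgeSet] at h1 ⊢
  exact ⟨h (List.mem_toFinset.2 he), h1.2⟩

lemma path_split {S : Finset (Sym2 V)} {a b u : V} (w : (H S).Walk a b) (hw : w.IsPath)
    (hu : u ∈ w.support) : ∃ S₁ S₂, S₁ ⊆ w.edges.toFinset ∧ S₂ ⊆ w.edges.toFinset ∧
      Disjoint S₁ S₂ ∧ R S₁ a u ∧ R S₂ u b := by
  refine ⟨(w.takeUntil u hu).edges.toFinset, (w.dropUntil u hu).edges.toFinset, ?_, ?_, ?_,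
    walk_R _ subset_rfl, walk_R _ subset_rfl⟩
  · intro e he
    rw [List.mem_toFinset] at he ⊢
    exact w.edges_takeUntil_subset_edges hu he
  · intro e he
    rw [List.mem_toFinset] at he ⊢
    exact w.edges_dropUntil_subset_edges hu he
  · rw [Finset.disjoint_left]
    intro e he he'
    rw [List.mem_toFinset] at he he'
    exact hw.isTrail.disjoint_edges_takeUntil_dropUntil hu he he'

lemma tg_event {S : Finset (Sym2 V)} {a x : V} {g : Finset V} (h1 : R S a x) (h2 : RG S a g) :
    ∃ u, Dis (fun S => R S a u) (Dis (fun S => R S u x) (fun S => RG S u g)) S := by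
  obtain ⟨w, hw⟩ := SimpleGraph.Reachable.exists_isPath h1
  obtain ⟨v, hv, h2⟩ := h2
  have key : ∃ u ∈ w.support, ∃ S₃ ⊆ S, Disjoint S₃ w.edges.toFinset ∧ R S₃ u v := by
    refine R_induct (P := fun v => ∃ u ∈ w.support, ∃ S₃ ⊆ S,
      Disjoint S₃ w.edges.toFinset ∧ R S₃ u v) ?_ ?_ (R_symm h2)
    · exact ⟨a, w.start_mem_support, ∅, by simp, by simp, R_refl _ _⟩
    · rintro c d hcd _ _ ⟨u, hu, S₃, hS, hd, hR⟩
      by_cases hc : c ∈ w.support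
      · exact ⟨c, hc, ∅, by simp, by simp, R_refl _ _⟩
      · refine ⟨u, hu, insert s(c, d) S₃, Finset.insert_subset hcd hS, ?_, ?_⟩
        · rw [Finset.disjoint_insert_left]
          refine ⟨fun h => hc ?_, hd⟩
          exact w.fst_mem_support_of_mem_edges (List.mem_toFinset.1 h)
        · refine R_trans (R_mono (Finset.subset_insert _ _) hR) (R_symm (R_edge ?_))
          exact Finset.mem_insert_self _ _
  obtain ⟨u, hu, S₃, hS, hd, hR⟩ := key
  obtain ⟨S₁, S₂, k1, k2, k3, k4, k5⟩ := path_split w hw hu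
  refine ⟨u, S₁, S₂ ∪ S₃, k1.trans (walk_subset w), Finset.union_subset (k2.trans (walk_subset w)) hS,
    ?_, k4, S₂, S₃, Finset.subset_union_left, Finset.subset_union_right, ?_, k5, v, hv, hR⟩
  · rw [Finset.disjoint_union_right]
    exact ⟨k3, (Finset.disjoint_of_subset_right k1 hd).symm⟩
  · exact (Finset.disjoint_of_subset_right k2 hd).symm

lemma off_event {S : Finset (Sym2 V)} {b : V} {g A : Finset V} (h1 : RG S b g)
    (h2 : ¬ RG (off S A) b g) :
    ∃ z ∈ A, Dis (fun S => R S b z) (fun S => RG S z g) S := by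
  obtain ⟨v, hv, h1⟩ := h1
  obtain ⟨w, hw⟩ := SimpleGraph.Reachable.exists_isPath h1
  by_cases h : ∃ z ∈ A, z ∈ w.support
  · obtain ⟨z, hz, hzw⟩ := h
    obtain ⟨S₁, S₂, k1, k2, k3, k4, k5⟩ := path_split w hw hzw
    exact ⟨z, hz, S₁, S₂, k1.trans (walk_subset w), k2.trans (walk_subset w), k3, k4, v, hv, k5⟩
  · exfalso
    apply h2
    refine ⟨v, hv, walk_R w ?_⟩
    intro e he
    rw [off, Finset.mem_filter]
    refine ⟨walk_subset w he, fun z hz hze => h ⟨z, hz, ?_⟩⟩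
    exact SimpleGraph.Walk.mem_support_of_mem_edges (List.mem_toFinset.1 he) hze

/-- Two-point function. -/
def tau (p : ℝ) (s : Finset (Sym2 V)) (x y : V) : ℝ := E p s (fun S => ind (R S x y))

/-- Probability of connection to `g`. -/
def taug (p : ℝ) (s : Finset (Sym2 V)) (x : V) (g : Finset V) : ℝ := E p s (fun S => ind (RG S x g))

variable {p : ℝ} {s : Finset (Sym2 V)}

lemma tau_comm (x y : V) : tau p s x y = tau p s y x :=
  E_congr fun _ _ => ind_congr R_comm

lemma tau_self (x : V) : tau p s x x = 1 := by
  rw [← E_const p s 1]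
  exact E_congr fun _ _ => ind_pos (R_refl _ _)

lemma tau_nonneg (hp0 : 0 ≤ p) (hp1 : p ≤ 1) (x y : V) : 0 ≤ tau p s x y :=
  E_nonneg hp0 hp1 fun _ _ => ind_nonneg _

lemma taug_nonneg (hp0 : 0 ≤ p) (hp1 : p ≤ 1) (x : V) (g : Finset V) : 0 ≤ taug p s x g :=
  E_nonneg hp0 hp1 fun _ _ => ind_nonneg _

lemma ind_exists_le {κ : Type*} (t : Finset κ) (P : κ → Prop) (Q : Prop)
    (h : Q → ∃ k ∈ t, P k) : ind Q ≤ ∑ k ∈ t, ind (P k) := by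
  by_cases hQ : Q
  · obtain ⟨k, hk, hP⟩ := h hQ
    rw [ind_pos hQ, ← ind_pos hP]
    exact Finset.single_le_sum (f := fun k => ind (P k)) (fun _ _ => ind_nonneg _) hk
  · rw [ind_neg hQ]; exact Finset.sum_nonneg fun _ _ => ind_nonneg _

/-- Tree-graph inequality. -/
lemma tree_graph (hp0 : 0 ≤ p) (hp1 : p ≤ 1 / 2) (s : Finset (Sym2 V)) (a x : V) (g : Finset V) :
    E p s (fun S => ind (R S a x ∧ RG S a g)) ≤
      ∑ u, tau p s a u * tau p s u x * taug p s u g := by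
  have hp1' : p ≤ 1 := by linarith
  calc E p s (fun S => ind (R S a x ∧ RG S a g))
      ≤ E p s (fun S => ∑ u, ind (Dis (fun S => R S a u)
          (Dis (fun S => R S u x) (fun S => RG S u g)) S)) := by
        refine E_mono hp0 hp1' fun S _ => ?_
        refine ind_exists_le _ _ _ fun h => ?_
        obtain ⟨u, hu⟩ := tg_event h.1 h.2
        exact ⟨u, Finset.mem_univ _, hu⟩
    _ = ∑ u, E p s (fun S => ind (Dis (fun S => R S a u)
          (Dis (fun S => R S u x) (fun S => RG S u g)) S)) := E_sum _ _
    _ ≤ ∑ u, tau p s a u * tau p s u x * taug p s u g := by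
        refine Finset.sum_le_sum fun u _ => ?_
        have h1 := BK hp0 hp1 s _ _ (R_inc a u) (Dis_inc (fun S => R S u x) (fun S => RG S u g))
        have h2 := BK hp0 hp1 s _ _ (R_inc u x) (RG_inc u g)
        rw [mul_assoc]
        exact h1.trans (mul_le_mul_of_nonneg_left h2 (tau_nonneg hp0 hp1' _ _))

lemma taug_off (hp0 : 0 ≤ p) (hp1 : p ≤ 1 / 2) (s : Finset (Sym2 V)) (b : V) (g A : Finset V) :
    taug p s b g - ∑ z ∈ A, tau p s b z * taug p s z g ≤
      E p s (fun S => ind (RG (off S A) b g)) := by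
  have hp1' : p ≤ 1 := by linarith
  have h1 : E p s (fun S => ind (RG S b g)) ≤ E p s (fun S => ind (RG (off S A) b g) +
      ∑ z ∈ A, ind (Dis (fun S => R S b z) (fun S => RG S z g) S)) := by
    refine E_mono hp0 hp1' fun S _ => ?_
    by_cases h2 : RG (off S A) b g
    · rw [ind_pos h2]
      have := ind_le_one (RG S b g)
      have : 0 ≤ ∑ z ∈ A, ind (Dis (fun S => R S b z) (fun S => RG S z g) S) :=
        Finset.sum_nonneg fun _ _ => ind_nonneg _
      linarith
    · rw [ind_neg h2, zero_add]
      exact ind_exists_le _ _ _ fun h => off_event h h2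
  rw [E_add, E_sum] at h1
  have h2 : ∑ z ∈ A, E p s (fun S => ind (Dis (fun S => R S b z) (fun S => RG S z g) S)) ≤
      ∑ z ∈ A, tau p s b z * taug p s z g :=
    Finset.sum_le_sum fun z _ => BK hp0 hp1 s _ _ (R_inc b z) (RG_inc z g)
  unfold taug at *
  linarith

lemma tau_off_le (hp0 : 0 ≤ p) (hp1 : p ≤ 1) (A : Finset V) (x y : V) :
    tau p (off s A) x y ≤ tau p s x y := by
  unfold tau off
  rw [← E_restrict]
  exact E_mono hp0 hp1 fun S _ => ind_mono (R_mono (Finset.filter_subset _ _))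

/-- Three point function for clusters avoiding `g`. -/
lemma three_point (hp0 : 0 ≤ p) (hp1 : p ≤ 1 / 2) (s : Finset (Sym2 V)) (w x z : V)
    (g : Finset V) :
    E p s (fun S => ind (R S w x ∧ R S w z ∧ ¬ RG S w g)) ≤
      ∑ u, tau p s w u * tau p s u z * E p s (fun S => ind (R S u x ∧ ¬ RG S u g)) := by
  have hp1' : p ≤ 1 := by linarith
  have step : ∀ u, E p s (fun S => ind (R S u x ∧ ¬ RG S u g)) =
      E p s (fun S => (fun A => ind (u ∉ A) * tau p (off s A) u x) (Cl S g)) := by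
    intro u
    have := explore p s g (fun A S => ind (u ∉ A) * ind (R S u x))
    simp only [E_mul] at this
    have h2 : ∀ A : Finset V, E p s (fun S' => ind (R (off S' A) u x)) = tau p (off s A) u x := by
      intro A; unfold tau off; rw [← E_restrict]
    simp only [h2] at this
    rw [← this]
    refine E_congr fun S _ => ?_
    by_cases hu : u ∈ Cl S g
    · rw [ind_neg, ind_neg (P := u ∉ Cl S g) (by simpa using hu), zero_mul]
      rintro ⟨_, h⟩
      exact h (mem_Cl.1 hu)
    · rw [ind_pos hu, one_mul]
      refine ind_congr ?_
      rw [R_off hu]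
      rw [mem_Cl] at hu
      tauto
  have h1 : E p s (fun S => ind (R S w x ∧ R S w z ∧ ¬ RG S w g)) =
      E p s (fun S => (fun A S => ind (w ∉ A) * ind (R S w z ∧ RG S w {x})) (Cl S g)
        (off S (Cl S g))) := by
    refine E_congr fun S _ => ?_
    by_cases hu : w ∈ Cl S g
    · simp only
      rw [ind_neg, ind_neg (P := w ∉ Cl S g) (by simpa using hu), zero_mul]
      rintro ⟨_, _, h⟩
      exact h (mem_Cl.1 hu)
    · simp only
      rw [ind_pos (P := w ∉ Cl S g) hu, one_mul]
      refine ind_congr ?_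
      rw [RG_singleton, R_off hu, R_off hu]
      rw [mem_Cl] at hu
      tauto
  rw [h1]
  simp only [step]
  simp only [← E_mul]
  rw [← E_sum]
  refine explore_le hp0 hp1' s g (fun A S => ind (w ∉ A) * ind (R S w z ∧ RG S w {x}))
    (fun A => ∑ u, tau p s w u * tau p s u z * (ind (u ∉ A) * tau p (off s A) u x)) ?_
  intro A
  by_cases hw : w ∈ A
  · rw [E_mul, ind_neg (by simpa using hw), zero_mul]
    refine Finset.sum_nonneg fun u _ => ?_
    have := tau_nonneg (s := s) hp0 hp1' w u
    have := tau_nonneg (s := s) hp0 hp1' u z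
    have := tau_nonneg (s := off s A) hp0 hp1' u x
    have := ind_nonneg (u ∉ A)
    positivity
  · rw [E_mul, ind_pos hw, one_mul]
    have h3 : E p s (fun S' => ind (R (off S' A) w z ∧ RG (off S' A) w {x})) =
        E p (off s A) (fun S' => ind (R S' w z ∧ RG S' w {x})) := by
      unfold off; rw [← E_restrict]
    rw [h3]
    refine (tree_graph hp0 hp1 (off s A) w z {x}).trans ?_
    refine Finset.sum_le_sum fun u _ => ?_
    have h4 : taug p (off s A) u {x} = tau p (off s A) u x :=
      E_congr fun S _ => ind_congr RG_singleton
    rw [h4]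
    have t1 := tau_nonneg (s := s) hp0 hp1' w u
    have t2 := tau_nonneg (s := s) hp0 hp1' u z
    have t3 := tau_nonneg (s := off s A) hp0 hp1' u x
    have t4 := tau_nonneg (s := off s A) hp0 hp1' u z
    by_cases hu : u ∈ A
    · have h5 : tau p (off s A) w u = 0 := by
        unfold tau
        rw [← E_const p (off s A) 0]
        refine E_congr fun S hS => ind_neg fun h => ?_
        have : S = off S A := by
          rw [off, Finset.filter_eq_self.2]
          intro e he
          exact (Finset.mem_filter.1 (hS he)).2
        rw [this] at h
        exact hw (R_off_of_mem hu h ▸ hu)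
      rw [h5, ind_neg (by simpa using hu)]
      simp
    · rw [ind_pos hu, one_mul]
      have := tau_off_le (s := s) hp0 hp1' A w u
      have := tau_off_le (s := s) hp0 hp1' A u z
      gcongr

end treegraph
end Perc

namespace Perc
section hom
variable {V : Type*} [Fintype V] [DecidableEq V]

/-- Expectation of a function of the cluster size. -/
def EK (p : ℝ) (s : Finset (Sym2 V)) (ψ : ℕ → ℝ) (x : V) : ℝ := E p s (fun S => ψ (K S x).card)

/-- Homogeneity: cluster size distributions do not depend on the vertex. -/
def Hom (s : Finset (Sym2 V)) : Prop := ∀ (p : ℝ) (ψ : ℕ → ℝ) (x y : V), EK p s ψ x = EK p s ψ y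

variable {p : ℝ} {s : Finset (Sym2 V)}

lemma card_K_eq (S : Finset (Sym2 V)) (x : V) : ((K S x).card : ℝ) = ∑ y, ind (R S x y) := by
  unfold ind K
  rw [Finset.sum_boole]

lemma card_K_pos (S : Finset (Sym2 V)) (x : V) : 1 ≤ (K S x).card :=
  Finset.card_pos.2 ⟨x, mem_K.2 (R_refl _ _)⟩

lemma sum_tau (x : V) : ∑ y, tau p s x y = EK p s (fun m => (m : ℝ)) x := by
  unfold EK tau
  rw [← E_sum]
  exact E_congr fun S _ => (card_K_eq S x).symm

lemma second_moment (hp0 : 0 ≤ p) (hp1 : p ≤ 1 / 2) (hs : Hom s) (x : V) :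
    EK p s (fun m => (m : ℝ) ^ 2) x ≤ EK p s (fun m => (m : ℝ)) x ^ 3 := by
  have h1 : EK p s (fun m => (m : ℝ) ^ 2) x =
      ∑ y, ∑ z, E p s (fun S => ind (R S x y ∧ RG S x {z})) := by
    simp only [← E_sum]
    refine E_congr fun S _ => ?_
    show ((K S x).card : ℝ) ^ 2 = _
    rw [card_K_eq, sq, Finset.sum_mul]
    refine Finset.sum_congr rfl fun y _ => ?_
    rw [Finset.mul_sum]
    refine Finset.sum_congr rfl fun z _ => ?_
    rw [RG_singleton, ind_and]
  have h2 : ∀ u, ∑ y, tau p s u y = EK p s (fun m => (m : ℝ)) x := fun u => by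
    rw [sum_tau]; exact hs _ _ _ _
  rw [h1]
  calc ∑ y, ∑ z, E p s (fun S => ind (R S x y ∧ RG S x {z}))
      ≤ ∑ y, ∑ z, ∑ u, tau p s x u * tau p s u y * tau p s u z := by
        refine Finset.sum_le_sum fun y _ => Finset.sum_le_sum fun z _ => ?_
        refine (tree_graph hp0 hp1 s x y {z}).trans (le_of_eq ?_)
        refine Finset.sum_congr rfl fun u _ => ?_
        congr 1
        exact E_congr fun S _ => ind_congr RG_singleton
    _ = ∑ u, ∑ y, ∑ z, tau p s x u * tau p s u y * tau p s u z := by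
        have h3 : ∀ y, ∑ z, ∑ u, tau p s x u * tau p s u y * tau p s u z =
            ∑ u, ∑ z, tau p s x u * tau p s u y * tau p s u z := fun y => Finset.sum_comm
        simp only [h3]
        rw [Finset.sum_comm]
    _ = EK p s (fun m => (m : ℝ)) x ^ 3 := by
        simp only [← Finset.mul_sum, ← Finset.sum_mul, h2]
        ring

lemma K_insert {S : Finset (Sym2 V)} {a b x y : V} (h : R (insert s(a, b) S) y x) :
    R S x y ∨ (R S x a ∧ R S b y) ∨ (R S x b ∧ R S a y) := by
  refine R_induct (P := fun y => R S x y ∨ (R S x a ∧ R S b y) ∨ (R S x b ∧ R S a y))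
    (Or.inl (R_refl _ _)) ?_ h
  intro c d hcd _ _ ih
  rcases Finset.mem_insert.1 hcd with h1 | h1
  · rcases Sym2.eq_iff.1 h1 with ⟨rfl, rfl⟩ | ⟨rfl, rfl⟩
    · rcases ih with h | h | h
      · exact Or.inr (Or.inr ⟨h, R_refl _ _⟩)
      · exact Or.inl h.1
      · exact Or.inl (R_trans h.1 (R_symm h.2))
    · rcases ih with h | h | h
      · exact Or.inr (Or.inl ⟨h, R_refl _ _⟩)
      · exact Or.inl (R_trans h.1 (R_symm h.2))
      · exact Or.inl h.1
  · have h2 : R S d c := R_symm (R_edge h1)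
    rcases ih with h | h | h
    · exact Or.inl (R_trans h h2)
    · exact Or.inr (Or.inl ⟨h.1, R_trans h.2 h2⟩)
    · exact Or.inr (Or.inr ⟨h.1, R_trans h.2 h2⟩)

/-- Gain term when opening the bond `ab`. -/
def gterm (n : ℝ) (x : V) (S : Finset (Sym2 V)) (a b : V) : ℝ :=
  ind (R S x a ∧ ¬ R S x b ∧ ((K S x).card : ℝ) < n) * min ((K S b).card : ℝ) n

lemma gterm_nonneg {n : ℝ} (hn : 0 ≤ n) (x : V) (S : Finset (Sym2 V)) (a b : V) :
    0 ≤ gterm n x S a b :=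
  mul_nonneg (ind_nonneg _) (le_min (Nat.cast_nonneg _) hn)

lemma gain_one {n : ℝ} (hn : 0 ≤ n) (x : V) (S : Finset (Sym2 V)) (a b : V) (ha : R S x a)
    (hb : ¬ R S x b) :
    min ((K (insert s(a, b) S) x).card : ℝ) n - min ((K S x).card : ℝ) n ≤ gterm n x S a b := by
  have h1 : (K (insert s(a, b) S) x).card ≤ (K S x).card + (K S b).card := by
    refine le_trans (Finset.card_le_card ?_) (Finset.card_union_le _ _)
    intro y hy
    rw [mem_K] at hy
    rw [Finset.mem_union, mem_K, mem_K]
    rcases K_insert (R_symm hy) with h | h | h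
    · exact Or.inl h
    · exact Or.inr h.2
    · exact absurd h.1 hb
  have h1' : ((K (insert s(a, b) S) x).card : ℝ) ≤ (K S x).card + (K S b).card := by
    exact_mod_cast h1
  have h0 : (0 : ℝ) ≤ (K S x).card := Nat.cast_nonneg _
  by_cases hK : ((K S x).card : ℝ) < n
  · rw [gterm, ind_pos ⟨ha, hb, hK⟩, one_mul, min_eq_left hK.le]
    refine le_min ?_ ?_
    · have := min_le_left ((K (insert s(a, b) S) x).card : ℝ) n; linarith
    · have := min_le_right ((K (insert s(a, b) S) x).card : ℝ) n; linarith
  · rw [min_eq_right (not_lt.1 hK)]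
    have := min_le_right ((K (insert s(a, b) S) x).card : ℝ) n
    have := gterm_nonneg hn x S a b
    linarith

lemma gain_le {n : ℝ} (hn : 0 ≤ n) (x : V) (S : Finset (Sym2 V)) (a b : V) :
    min ((K (insert s(a, b) S) x).card : ℝ) n - min ((K S x).card : ℝ) n ≤
      gterm n x S a b + gterm n x S b a := by
  have t1 := gterm_nonneg hn x S a b
  have t2 := gterm_nonneg hn x S b a
  by_cases ha : R S x a
  · by_cases hb : R S x b
    · have : K (insert s(a, b) S) x ⊆ K S x := by
        intro y hy
        rw [mem_K] at hy ⊢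
        rcases K_insert (R_symm hy) with h | h | h
        · exact h
        · exact R_trans hb h.2
        · exact R_trans ha h.2
      have h2 : ((K (insert s(a, b) S) x).card : ℝ) ≤ (K S x).card := by
        exact_mod_cast Finset.card_le_card this
      have := min_le_min_right n h2
      linarith
    · have := gain_one hn x S a b ha hb; linarith
  · by_cases hb : R S x b
    · have := gain_one hn x S b a hb ha
      rw [Sym2.eq_swap] at this
      linarith
    · have : K (insert s(a, b) S) x ⊆ K S x := by
        intro y hy
        rw [mem_K] at hy ⊢
        rcases K_insert (R_symm hy) with h | h | h
        · exact h
        · exact absurd h.1 ha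
        · exact absurd h.1 hb
      have h2 : ((K (insert s(a, b) S) x).card : ℝ) ≤ (K S x).card := by
        exact_mod_cast Finset.card_le_card this
      have := min_le_min_right n h2
      linarith

lemma gterm_E (hp0 : 0 ≤ p) (hp1 : p ≤ 1) {n : ℝ} (hn : 0 ≤ n) (x a b : V) :
    E p s (fun S => gterm n x S a b) ≤
      E p s (fun S => ind (R S x a) * ind (((K S x).card : ℝ) < n)) *
        EK p s (fun m => min (m : ℝ) n) b := by
  have h1 : ∀ S : Finset (Sym2 V), gterm n x S a b = (fun A S => ind (a ∈ A ∧ b ∉ A ∧ (A.card : ℝ) < n) *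
      min ((K S b).card : ℝ) n) (Cl S {x}) (off S (Cl S {x})) := by
    intro S
    simp only [gterm]
    by_cases hb : b ∈ Cl S {x}
    · rw [ind_neg, ind_neg]
      · ring
      · tauto
      · rw [← K_eq_Cl, mem_K] at hb; tauto
    · rw [K_off hb, ← K_eq_Cl, mem_K, mem_K]
  have h2 : ∀ S : Finset (Sym2 V), ind (R S x a) * ind (((K S x).card : ℝ) < n) *
        EK p s (fun m => min (m : ℝ) n) b = (fun A => ind (a ∈ A) * ind ((A.card : ℝ) < n) *
        EK p s (fun m => min (m : ℝ) n) b) (Cl S {x}) := by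
    intro S
    simp only [← K_eq_Cl, mem_K]
  rw [← E_mul_right]
  simp only [h1, h2]
  have h0 : 0 ≤ EK p s (fun m => min (m : ℝ) n) b :=
    E_nonneg hp0 hp1 fun S _ => le_min (Nat.cast_nonneg _) hn
  refine explore_le hp0 hp1 s {x} (fun A S => ind (a ∈ A ∧ b ∉ A ∧ (A.card : ℝ) < n) *
      min ((K S b).card : ℝ) n) (fun A => ind (a ∈ A) * ind ((A.card : ℝ) < n) *
        EK p s (fun m => min (m : ℝ) n) b) ?_
  intro A
  rw [E_mul]
  refine mul_le_mul ?_ ?_ ?_ ?_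
  · rw [← ind_and]; exact ind_mono (by tauto)
  · refine E_mono hp0 hp1 fun S _ => min_le_min_right _ ?_
    exact_mod_cast Finset.card_le_card (K_mono (off_subset _ _) _)
  · exact E_nonneg hp0 hp1 fun S _ => le_min (Nat.cast_nonneg _) hn
  · exact mul_nonneg (ind_nonneg _) (ind_nonneg _)

lemma f_deriv_le (hp0 : 0 ≤ p) (hp1 : p ≤ 1) (hs : Hom s) (hloop : ∀ a : V, s(a, a) ∉ s) (Ω : ℕ)
    (hdeg : ∀ a : V, (Finset.univ.filter fun b => s(a, b) ∈ s).card = Ω) {n : ℝ} (hn : 0 ≤ n)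
    (x : V) :
    (1 - p) * ∑ e ∈ s, E p s (fun S => min ((K (insert e S) x).card : ℝ) n -
        min ((K (S.erase e) x).card : ℝ) n) ≤
      Ω * EK p s (fun m => min (m : ℝ) n) x ^ 2 := by
  set f := EK p s (fun m => min (m : ℝ) n) x with hf
  have hf0 : 0 ≤ f := E_nonneg hp0 hp1 fun S _ => le_min (Nat.cast_nonneg _) hn
  have h1 : ∀ e ∈ s, (1 - p) * E p s (fun S => min ((K (insert e S) x).card : ℝ) n -
        min ((K (S.erase e) x).card : ℝ) n) ≤
      ∑ q ∈ Finset.univ.filter (fun q : V × V => s(q.1, q.2) = e),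
        E p s (fun S => gterm n x S q.1 q.2) := by
    intro e he
    rw [E_closed p he (fun S => min ((K S x).card : ℝ) n), ← E_sum]
    refine E_mono hp0 hp1 fun S _ => ?_
    induction e using Sym2.ind with
    | _ a b =>
      have hab : a ≠ b := by rintro rfl; exact hloop _ he
      have hg := gain_le hn x S a b
      have hsum : gterm n x S a b + gterm n x S b a ≤
          ∑ q ∈ Finset.univ.filter (fun q : V × V => s(q.1, q.2) = s(a, b)),
            gterm n x S q.1 q.2 := by
        have hsub : ({(a, b), (b, a)} : Finset (V × V)) ⊆
            Finset.univ.filter (fun q : V × V => s(q.1, q.2) = s(a, b)) := by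
          intro q hq
          rw [Finset.mem_insert, Finset.mem_singleton] at hq
          rcases hq with rfl | rfl
          · simp
          · simp [Sym2.eq_swap]
        refine le_trans (le_of_eq ?_) (Finset.sum_le_sum_of_subset_of_nonneg hsub
          (fun q _ _ => gterm_nonneg hn x S q.1 q.2))
        rw [Finset.sum_pair]
        intro h; exact hab (congrArg Prod.fst h)
      have h0 : 0 ≤ ∑ q ∈ Finset.univ.filter (fun q : V × V => s(q.1, q.2) = s(a, b)),
            gterm n x S q.1 q.2 := Finset.sum_nonneg fun q _ => gterm_nonneg hn x S q.1 q.2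
      by_cases hS : s(a, b) ∉ S
      · rw [ind_pos hS, one_mul]; linarith
      · rw [ind_neg hS, zero_mul]; exact h0
  rw [Finset.mul_sum]
  refine (Finset.sum_le_sum h1).trans ?_
  have h2 : ∑ e ∈ s, ∑ q ∈ Finset.univ.filter (fun q : V × V => s(q.1, q.2) = e),
        E p s (fun S => gterm n x S q.1 q.2) =
      ∑ a, ∑ b ∈ Finset.univ.filter (fun b => s(a, b) ∈ s), E p s (fun S => gterm n x S a b) := by
    rw [Finset.sum_fiberwise_eq_sum_filter (s := Finset.univ) (t := s)
      (g := fun q : V × V => s(q.1, q.2)) (f := fun q => E p s (fun S => gterm n x S q.1 q.2))]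
    rw [Finset.sum_filter, Fintype.sum_prod_type]
    refine Finset.sum_congr rfl fun a _ => ?_
    rw [Finset.sum_filter]
  rw [h2]
  calc ∑ a, ∑ b ∈ Finset.univ.filter (fun b => s(a, b) ∈ s), E p s (fun S => gterm n x S a b)
      ≤ ∑ a, ∑ b ∈ Finset.univ.filter (fun b => s(a, b) ∈ s),
          E p s (fun S => ind (R S x a) * ind (((K S x).card : ℝ) < n)) * f := by
        refine Finset.sum_le_sum fun a _ => Finset.sum_le_sum fun b _ => ?_
        rw [hf, hs p _ x b]
        exact gterm_E hp0 hp1 hn x a b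
    _ = Ω * f * E p s (fun S => ((K S x).card : ℝ) * ind (((K S x).card : ℝ) < n)) := by
        simp only [Finset.sum_const, hdeg, nsmul_eq_mul]
        rw [← Finset.mul_sum, ← Finset.sum_mul, ← E_sum]
        simp only [← Finset.sum_mul, ← card_K_eq]
        ring
    _ ≤ Ω * f * f := by
        refine mul_le_mul_of_nonneg_left ?_ (by positivity)
        refine E_mono hp0 hp1 fun S _ => ?_
        show _ ≤ min ((K S x).card : ℝ) n
        by_cases h : ((K S x).card : ℝ) < n
        · rw [ind_pos h, mul_one, min_eq_left h.le]
        · rw [ind_neg h, mul_zero]; exact le_min (Nat.cast_nonneg _) hn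
    _ = Ω * f ^ 2 := by ring

end hom
end Perc

namespace Perc
section branch
variable {V : Type*} [Fintype V] [DecidableEq V]

/-- Leaving edge between two configurations. -/
lemma R_exit {S T : Finset (Sym2 V)} {x y : V} (h : R S x y) (h' : ¬ R T x y) :
    ∃ u v, R S x u ∧ s(u, v) ∈ S ∧ s(u, v) ∉ T := by
  by_contra hc
  push Not at hc
  apply h'
  have key : ∀ z, R S z x → R T z x := by
    intro z hz
    refine R_induct (P := fun z => R T z x) (R_refl _ _) ?_ hz
    intro a b hab _ hb ih
    have h1 : s(b, a) ∈ T := hc b a (R_symm hb) (by rwa [Sym2.eq_swap])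
    exact R_trans (R_symm (R_edge h1)) ih
  exact R_symm (key y (R_symm h))

lemma RG_exit {S T : Finset (Sym2 V)} {x : V} {g : Finset V} (h : RG S x g) (h' : ¬ RG T x g) :
    ∃ u v, R S x u ∧ s(u, v) ∈ S ∧ s(u, v) ∉ T := by
  obtain ⟨y, hy, hxy⟩ := h
  exact R_exit hxy (fun h => h' ⟨y, hy, h⟩)

/-- The branch event after removal of the two edges. -/
def Dev (g : Finset V) (x w a b : V) (S : Finset (Sym2 V)) : Prop :=
  R S x w ∧ ¬ RG S w g ∧ RG S a g ∧ RG S b g ∧ ¬ R S a b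

/-- The branch event. -/
def Br (g : Finset V) (x w a b : V) (S : Finset (Sym2 V)) : Prop :=
  s(w, a) ∈ S ∧ s(w, b) ∈ S ∧ Dev g x w a b ((S.erase s(w, a)).erase s(w, b))

lemma Br_case {g : Finset V} {x w a b w' a' b' : V} {S : Finset (Sym2 V)}
    (h : Br g x w a b S) (h' : Br g x w' a' b' S)
    (hc : R ((S.erase s(w', a')).erase s(w', b')) x w) :
    w = w' ∧ ((a = a' ∧ b = b') ∨ (a = b' ∧ b = a')) := by
  obtain ⟨he1, he2, hxw, hw, ha, hb, hab⟩ := h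
  obtain ⟨he1', he2', hxw', hw', ha', hb', hab'⟩ := h'
  set T := (S.erase s(w, a)).erase s(w, b) with hT
  set T' := (S.erase s(w', a')).erase s(w', b') with hT'
  have hx' : ¬ RG T' x g := fun h => hw' (RG_of_R (R_symm hxw') h)
  have hmem : ∀ e ∈ S, e ∉ T' → e = s(w', a') ∨ e = s(w', b') := by
    intro e he hn
    by_contra hcon
    push Not at hcon
    exact hn (Finset.mem_erase.2 ⟨hcon.2, Finset.mem_erase.2 ⟨hcon.1, he⟩⟩)
  have hTS : T ⊆ S := (Finset.erase_subset _ _).trans (Finset.erase_subset _ _)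
  have haux : ∀ c, s(w, c) ∈ S → RG T c g → s(w, c) ∈ T' → R T c w' := by
    intro c hcS hcg hcT
    have h1 : ¬ RG T' c g := fun h => hx' (RG_of_R (R_trans hc (R_edge hcT)) h)
    obtain ⟨u, v, hu, hv, hv'⟩ := RG_exit hcg h1
    have huv := R_edge hv
    rcases hmem _ (hTS hv) hv' with h2 | h2 <;>
    · rcases Sym2.eq_iff.1 h2 with ⟨rfl, rfl⟩ | ⟨rfl, rfl⟩
      · exact hu
      · exact R_trans hu huv
  have hwa : w ≠ a := fun h => hw (h ▸ ha)
  have hwb : w ≠ b := fun h => hw (h ▸ hb)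
  have hne : a ≠ b := fun h => hab (h ▸ R_refl _ _)
  have hne' : a' ≠ b' := fun h => hab' (h ▸ R_refl _ _)
  have m1 : s(w, a) ∉ T' := by
    intro h1
    have r1 := haux a he1 ha h1
    by_cases h2 : s(w, b) ∈ T'
    · exact hab (R_trans r1 (R_symm (haux b he2 hb h2)))
    · have : w' = w ∨ w' = b := by
        rcases hmem _ he2 h2 with h3 | h3 <;>
        · rcases Sym2.eq_iff.1 h3 with ⟨h4, h5⟩ | ⟨h4, h5⟩
          · exact Or.inl h4.symm
          · exact Or.inr h5.symm
      rcases this with h3 | h3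
      · rw [h3] at r1; exact hw (RG_of_R (R_symm r1) ha)
      · rw [h3] at r1; exact hab r1
  have m2 : s(w, b) ∉ T' := by
    intro h1
    have r1 := haux b he2 hb h1
    have : w' = w ∨ w' = a := by
      rcases hmem _ he1 m1 with h3 | h3 <;>
      · rcases Sym2.eq_iff.1 h3 with ⟨h4, h5⟩ | ⟨h4, h5⟩
        · exact Or.inl h4.symm
        · exact Or.inr h5.symm
    rcases this with h3 | h3
    · rw [h3] at r1; exact hw (RG_of_R (R_symm r1) hb)
    · rw [h3] at r1; exact hab (R_symm r1)
  have q1 := hmem _ he1 m1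
  have q2 := hmem _ he2 m2
  simp only [Sym2.eq_iff] at q1 q2
  clear_value T T'
  grind

lemma Br_unique {g : Finset V} {x w a b w' a' b' : V} {S : Finset (Sym2 V)}
    (h : Br g x w a b S) (h' : Br g x w' a' b' S) :
    w = w' ∧ ((a = a' ∧ b = b') ∨ (a = b' ∧ b = a')) := by
  by_cases hc : R ((S.erase s(w', a')).erase s(w', b')) x w
  · exact Br_case h h' hc
  · have hxw := h.2.2.1
    obtain ⟨u, v, hu, hv, hv'⟩ := R_exit hxw hc
    have huv := R_edge hv
    have hTS : s(u, v) ∈ S :=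
      ((Finset.erase_subset _ _).trans (Finset.erase_subset _ _)) hv
    have h2 : s(u, v) = s(w', a') ∨ s(u, v) = s(w', b') := by
      by_contra hcon
      push Not at hcon
      exact hv' (Finset.mem_erase.2 ⟨hcon.2, Finset.mem_erase.2 ⟨hcon.1, hTS⟩⟩)
    have hr : R ((S.erase s(w, a)).erase s(w, b)) x w' := by
      rcases h2 with h2 | h2 <;>
      · rcases Sym2.eq_iff.1 h2 with ⟨rfl, rfl⟩ | ⟨rfl, rfl⟩
        · exact hu
        · exact R_trans hu huv
    have := Br_case h' h hr
    grind

lemma Br_RG {g : Finset V} {x w a b : V} {S : Finset (Sym2 V)} (h : Br g x w a b S) :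
    RG S x g := by
  obtain ⟨he1, he2, hxw, hw, ha, hb, hab⟩ := h
  have hTS : (S.erase s(w, a)).erase s(w, b) ⊆ S :=
    (Finset.erase_subset _ _).trans (Finset.erase_subset _ _)
  exact RG_of_R (R_trans (R_mono hTS hxw) (R_edge he1)) (RG_mono hTS ha)

lemma Br_count (g : Finset V) (x : V) (S : Finset (Sym2 V)) (t : Finset (V × V × V)) :
    ∑ q ∈ t, ind (Br g x q.1 q.2.1 q.2.2 S) ≤ 2 * ind (RG S x g) := by
  by_cases hex : ∃ q : V × V × V, Br g x q.1 q.2.1 q.2.2 S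
  · obtain ⟨⟨w, a, b⟩, hq⟩ := hex
    rw [ind_pos (Br_RG hq)]
    unfold ind
    rw [Finset.sum_boole]
    have : t.filter (fun q => Br g x q.1 q.2.1 q.2.2 S) ⊆ {(w, a, b), (w, b, a)} := by
      rintro ⟨w', a', b'⟩ h'
      have h2 := Br_unique hq (Finset.mem_filter.1 h').2
      simp only [Finset.mem_insert, Finset.mem_singleton, Prod.mk.injEq]
      simp only at h2
      grind
    have h3 := (Finset.card_le_card this).trans Finset.card_le_two
    norm_num
    exact_mod_cast h3
  · push Not at hex
    rw [Finset.sum_eq_zero (fun q _ => ind_neg (hex q))]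
    have := ind_nonneg (RG S x g)
    linarith

variable {p : ℝ} {s : Finset (Sym2 V)}

lemma Br_E (g : Finset V) (x w a b : V) (ha : s(w, a) ∈ s) (hb : s(w, b) ∈ s) (hab : a ≠ b) :
    (1 - p) ^ 2 * E p s (fun S => ind (Br g x w a b S)) =
      p ^ 2 * E p s (fun S => ind (Dev g x w a b S)) := by
  have hne : s(w, a) ≠ s(w, b) := by
    intro h; rw [Sym2.eq_iff] at h; grind
  have h1 := E_open p ha (fun S => ind (s(w, b) ∈ S) * ind (Dev g x w a b (S.erase s(w, b))))
  have h2 := E_open p hb (fun S => ind (s(w, a) ∉ S) * ind (Dev g x w a b S))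
  have e1 : E p s (fun S => ind (Br g x w a b S)) = E p s (fun S => ind (s(w, a) ∈ S) *
      (ind (s(w, b) ∈ S.erase s(w, a)) * ind (Dev g x w a b ((S.erase s(w, a)).erase s(w, b))))) := by
    refine E_congr fun S _ => ?_
    unfold Br
    rw [ind_and, ind_and]
    congr 2
    exact ind_congr (by simp [hne.symm])
  have e2 : E p s (fun S => ind (s(w, a) ∉ S) * (ind (s(w, b) ∈ S) *
      ind (Dev g x w a b (S.erase s(w, b))))) = E p s (fun S => ind (s(w, b) ∈ S) *
      (ind (s(w, a) ∉ S.erase s(w, b)) * ind (Dev g x w a b (S.erase s(w, b))))) := by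
    refine E_congr fun S _ => ?_
    have : ind (s(w, a) ∉ S.erase s(w, b)) = ind (s(w, a) ∉ S) := ind_congr (by simp [hne])
    rw [this]; ring
  have e3 : E p s (fun S => ind (s(w, b) ∉ S) * (ind (s(w, a) ∉ S) * ind (Dev g x w a b S))) =
      E p s (fun S => ind (Dev g x w a b S)) := by
    refine E_congr fun S _ => ?_
    rw [← ind_and, ← ind_and]
    refine ind_congr ⟨fun h => h.2.2, fun h => ⟨fun h' => ?_, fun h' => ?_, h⟩⟩
    · exact h.2.1 (RG_of_R (R_edge h') h.2.2.2.1)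
    · exact h.2.1 (RG_of_R (R_edge h') h.2.2.1)
  rw [e1]
  rw [e2] at h1
  rw [e3] at h2
  calc _ = (1 - p) * ((1 - p) * E p s (fun S => ind (s(w, a) ∈ S) *
      (ind (s(w, b) ∈ S.erase s(w, a)) *
        ind (Dev g x w a b ((S.erase s(w, a)).erase s(w, b)))))) := by ring
    _ = p * (p * E p s (fun S => ind (Dev g x w a b S))) := by rw [← h1, h2]; ring
    _ = _ := by ring

/-- Triples centred at `w`. -/
def trip (s : Finset (Sym2 V)) : Finset (V × V × V) :=
  Finset.univ.filter fun q => s(q.1, q.2.1) ∈ s ∧ s(q.1, q.2.2) ∈ s ∧ q.2.1 ≠ q.2.2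

lemma Br_total (hp0 : 0 ≤ p) (hp1 : p ≤ 1) (g : Finset V) (x : V) :
    p ^ 2 * ∑ q ∈ trip s, E p s (fun S => ind (Dev g x q.1 q.2.1 q.2.2 S)) ≤ 2 * taug p s x g := by
  calc p ^ 2 * ∑ q ∈ trip s, E p s (fun S => ind (Dev g x q.1 q.2.1 q.2.2 S))
      = (1 - p) ^ 2 * E p s (fun S => ∑ q ∈ trip s, ind (Br g x q.1 q.2.1 q.2.2 S)) := by
        rw [E_sum, Finset.mul_sum, Finset.mul_sum]
        refine Finset.sum_congr rfl fun q hq => ?_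
        have hq' := (Finset.mem_filter.1 hq).2
        exact (Br_E g x _ _ _ hq'.1 hq'.2.1 hq'.2.2).symm
    _ ≤ (1 - p) ^ 2 * E p s (fun S => 2 * ind (RG S x g)) := by
        refine mul_le_mul_of_nonneg_left ?_ (sq_nonneg _)
        exact E_mono hp0 hp1 fun S _ => Br_count g x S _
    _ = (1 - p) ^ 2 * (2 * taug p s x g) := by rw [E_mul]; rfl
    _ ≤ 1 * (2 * taug p s x g) := by
        have := taug_nonneg (s := s) hp0 hp1 x g
        refine mul_le_mul_of_nonneg_right ?_ (by linarith)
        nlinarith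
    _ = _ := one_mul _

end branch
end Perc

namespace Perc
section lower
variable {V : Type*} [Fintype V] [DecidableEq V]

/-- Ghost-field weight. -/
def phi (h : ℝ) (m : ℕ) : ℝ := 1 - (1 - h) ^ m

/-- Weight for the susceptibility in a ghost field. -/
def xw (h : ℝ) (m : ℕ) : ℝ := (m : ℝ) * (1 - h) ^ m

lemma phi_nonneg {h : ℝ} (h0 : 0 ≤ h) (h1 : h ≤ 1) (m : ℕ) : 0 ≤ phi h m := by
  unfold phi
  have := pow_le_one₀ (n := m) (by linarith : 0 ≤ 1 - h) (by linarith)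
  linarith

lemma phi_mono {h : ℝ} (h0 : 0 ≤ h) (h1 : h ≤ 1) {m n : ℕ} (hmn : m ≤ n) : phi h m ≤ phi h n := by
  unfold phi
  have := pow_le_pow_of_le_one (by linarith : 0 ≤ 1 - h) (by linarith) hmn
  linarith

lemma xw_nonneg {h : ℝ} (h1 : h ≤ 1) (m : ℕ) : 0 ≤ xw h m := by
  unfold xw
  have : 0 ≤ 1 - h := by linarith
  positivity

variable {p : ℝ} {s : Finset (Sym2 V)} {h : ℝ}

lemma avg_miss (S : Finset (Sym2 V)) (x : V) :
    E h Finset.univ (fun g => ind (¬ RG S x g)) = (1 - h) ^ (K S x).card := by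
  rw [← E_miss h Finset.univ _ (Finset.subset_univ _)]
  exact E_congr fun g _ => ind_congr (by rw [RG_iff_K, not_not])

lemma avg_hit (S : Finset (Sym2 V)) (x : V) :
    E h Finset.univ (fun g => ind (RG S x g)) = phi h (K S x).card := by
  unfold phi
  rw [← avg_miss, ← E_const h (Finset.univ : Finset V) 1, ← E_sub]
  refine E_congr fun g _ => ?_
  rw [ind_not]; ring

lemma avg_taug (x : V) : E h Finset.univ (fun g => taug p s x g) = EK p s (phi h) x := by
  unfold taug EK
  rw [← E_comm]
  exact E_congr fun S _ => avg_hit S x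

lemma avg_three {A B C : Finset V} (hAB : Disjoint A B) (hAC : Disjoint A C) (hBC : Disjoint B C) :
    E h Finset.univ (fun g => ind (Disjoint A g) * (ind (¬ Disjoint B g) * ind (¬ Disjoint C g))) =
      (1 - h) ^ A.card * (phi h B.card * phi h C.card) := by
  have e : ∀ g : Finset V,
      ind (Disjoint A g) * (ind (¬ Disjoint B g) * ind (¬ Disjoint C g)) =
      ind (Disjoint A g) - ind (Disjoint (A ∪ B) g) - ind (Disjoint (A ∪ C) g) +
        ind (Disjoint (A ∪ B ∪ C) g) := by
    intro g
    simp only [Finset.disjoint_union_left, ind_and, ind_not]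
    ring
  have m := fun A => E_miss h (Finset.univ : Finset V) A (Finset.subset_univ _)
  simp only [e]
  rw [E_add, E_sub, E_sub, m, m, m, m]
  have hABC : Disjoint (A ∪ B) C := Finset.disjoint_union_left.2 ⟨hAC, hBC⟩
  rw [Finset.card_union_of_disjoint hABC, Finset.card_union_of_disjoint hAB,
    Finset.card_union_of_disjoint hAC]
  unfold phi
  ring

/-- The tree diagram bound averaged over the ghost field. -/
lemma tree_avg (hp0 : 0 ≤ p) (hp1 : p ≤ 1 / 2) (h0 : 0 ≤ h) (h1 : h ≤ 1) (hs : Hom s) (a z : V) :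
    E p s (fun S => ind (R S a z) * phi h (K S a).card) ≤
      (∑ u, tau p s a u * tau p s u z) * EK p s (phi h) a := by
  have e : E p s (fun S => ind (R S a z) * phi h (K S a).card) =
      E h Finset.univ (fun g => E p s (fun S => ind (R S a z ∧ RG S a g))) := by
    rw [← E_comm]
    refine E_congr fun S _ => ?_
    rw [← avg_hit, ← E_mul]
    exact E_congr fun g _ => (ind_and _ _).symm
  rw [e]
  calc _ ≤ E h Finset.univ (fun g => ∑ u, tau p s a u * tau p s u z * taug p s u g) :=
        E_mono h0 h1 fun g _ => tree_graph hp0 hp1 s a z g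
    _ = ∑ u, tau p s a u * tau p s u z * EK p s (phi h) a := by
        rw [E_sum]
        refine Finset.sum_congr rfl fun u _ => ?_
        rw [E_mul, avg_taug, hs p _ u a]
    _ = _ := by rw [Finset.sum_mul]

lemma off_avg (hp0 : 0 ≤ p) (hp1 : p ≤ 1 / 2) (h0 : 0 ≤ h) (h1 : h ≤ 1) (b : V) (A : Finset V) :
    EK p s (phi h) b - ∑ z ∈ A, tau p s b z * EK p s (phi h) z ≤
      E p s (fun S => phi h (K (off S A) b).card) := by
  have e : E p s (fun S => phi h (K (off S A) b).card) =
      E h Finset.univ (fun g => E p s (fun S => ind (RG (off S A) b g))) := by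
    rw [← E_comm]
    exact E_congr fun S _ => (avg_hit _ _).symm
  rw [e]
  calc _ = E h Finset.univ (fun g => taug p s b g - ∑ z ∈ A, tau p s b z * taug p s z g) := by
        rw [E_sub, E_sum, avg_taug]
        congr 1
        refine Finset.sum_congr rfl fun u _ => ?_
        rw [E_mul, avg_taug]
    _ ≤ _ := E_mono h0 h1 fun g _ => taug_off hp0 hp1 s b g A

lemma three_avg (hp0 : 0 ≤ p) (hp1 : p ≤ 1 / 2) (h0 : 0 ≤ h) (h1 : h ≤ 1) (hs : Hom s) (w z : V) :
    E p s (fun S => ind (R S w z) * xw h (K S w).card) ≤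
      (∑ u, tau p s w u * tau p s u z) * EK p s (xw h) w := by
  have gen : ∀ (u : V) (P : Finset (Sym2 V) → Prop),
      E p s (fun S => ind (P S) * xw h (K S u).card) =
      ∑ x, E h Finset.univ (fun g => E p s (fun S => ind (R S u x ∧ P S ∧ ¬ RG S u g))) := by
    intro u P
    simp only [← E_comm (p := p)]
    rw [← E_sum]
    refine E_congr fun S _ => ?_
    unfold xw
    rw [card_K_eq, ← avg_miss, ← mul_assoc, Finset.mul_sum, Finset.sum_mul]
    refine Finset.sum_congr rfl fun x _ => ?_
    rw [← E_mul]
    refine E_congr fun g _ => ?_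
    rw [ind_and, ind_and]; ring
  rw [gen w (fun S => R S w z)]
  have hx : ∀ u, ∑ x, E h Finset.univ (fun g => E p s (fun S => ind (R S u x ∧ ¬ RG S u g))) =
      EK p s (xw h) w := by
    intro u
    rw [hs p _ w u]
    have := gen u (fun _ => True)
    simp only [ind_pos, one_mul, true_and] at this
    exact this.symm
  calc _ ≤ ∑ x, E h Finset.univ (fun g => ∑ u, tau p s w u * tau p s u z *
          E p s (fun S => ind (R S u x ∧ ¬ RG S u g))) :=
        Finset.sum_le_sum fun x _ => E_mono h0 h1 fun g _ => three_point hp0 hp1 s w x z g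
    _ = ∑ u, tau p s w u * tau p s u z * EK p s (xw h) w := by
        simp only [E_sum, E_mul]
        rw [Finset.sum_comm]
        refine Finset.sum_congr rfl fun u _ => ?_
        rw [← Finset.mul_sum, hx]
    _ = _ := by rw [Finset.sum_mul]

/-- Triangle diagram. -/
def tri (p : ℝ) (s : Finset (Sym2 V)) (x y : V) : ℝ :=
  ∑ u, ∑ v, tau p s x u * tau p s u v * tau p s v y

lemma tri_eq (x y : V) : ∑ z, tau p s y z * (∑ u, tau p s x u * tau p s u z) = tri p s x y := by
  unfold tri
  rw [Finset.sum_comm]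
  refine Finset.sum_congr rfl fun z _ => ?_
  rw [Finset.mul_sum]
  refine Finset.sum_congr rfl fun u _ => ?_
  rw [tau_comm y z]; ring

/-- Second exploration step. -/
lemma Q_lower (hp0 : 0 ≤ p) (hp1 : p ≤ 1 / 2) (h0 : 0 ≤ h) (h1 : h ≤ 1) (hs : Hom s)
    (A : Finset V) (a b : V) (M : ℝ) (hM : ∀ x, EK p s (phi h) x = M) :
    M ^ 2 * (1 - ∑ z ∈ A, tau p s a z - ∑ z ∈ A, tau p s b z - tri p s a b) ≤
      E p s (fun S => ind (b ∉ K (off S A) a) * (phi h (K (off S A) a).card *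
        phi h (K (off (off S A) (K (off S A) a)) b).card)) := by
  have hp1' : p ≤ 1 := by linarith
  set sA := off s A with hsA
  set X : V → ℝ := fun x => EK p sA (phi h) x with hX
  have hM0 : 0 ≤ M := by
    rw [← hM a]; exact E_nonneg hp0 hp1' fun S _ => phi_nonneg h0 h1 _
  have hX0 : ∀ x, 0 ≤ X x := fun x => E_nonneg hp0 hp1' fun S _ => phi_nonneg h0 h1 _
  have hXE : ∀ x, X x = E p s (fun S => phi h (K (off S A) x).card) := fun x =>
    (E_restrict p s (offE A) (fun S => phi h (K S x).card)).symm
  have hXM : ∀ x, X x ≤ M := by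
    intro x
    rw [hXE, ← hM x]
    exact E_mono hp0 hp1' fun S _ =>
      phi_mono h0 h1 (Finset.card_le_card (K_mono (off_subset _ _) _))
  have hXl : ∀ x, M - M * ∑ z ∈ A, tau p s x z ≤ X x := by
    intro x
    rw [hXE]
    refine le_trans (le_of_eq ?_) (off_avg hp0 hp1 h0 h1 x A)
    simp only [hM]
    rw [← Finset.sum_mul]; ring
  have hτ : ∀ x y, 0 ≤ tau p s x y := tau_nonneg hp0 hp1'
  have step1 : E p s (fun S => ind (b ∉ K (off S A) a) * (phi h (K (off S A) a).card *
        phi h (K (off (off S A) (K (off S A) a)) b).card)) =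
      E p sA (fun S => ind (b ∉ K S a) * (phi h (K S a).card *
        phi h (K (off S (K S a)) b).card)) :=
    E_restrict p s (offE A) (fun S => ind (b ∉ K S a) * (phi h (K S a).card *
        phi h (K (off S (K S a)) b).card))
  rw [step1]
  have step2 : E p sA (fun S => phi h (K S a).card * (X b - M * ∑ z ∈ K S a, tau p s b z)) ≤
      E p sA (fun S => ind (b ∉ K S a) * (phi h (K S a).card *
        phi h (K (off S (K S a)) b).card)) := by
    have := explore_ge hp0 hp1' sA {a}
      (fun B S => ind (b ∉ B) * (phi h B.card * phi h (K S b).card))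
      (fun B => phi h B.card * (X b - M * ∑ z ∈ B, tau p s b z)) ?_
    · simpa only [← K_eq_Cl] using this
    · intro B
      rw [E_mul, E_mul]
      by_cases hb : b ∈ B
      · rw [ind_neg (by simpa using hb), zero_mul]
        refine mul_nonpos_of_nonneg_of_nonpos (phi_nonneg h0 h1 _) ?_
        have h2 : 1 ≤ ∑ z ∈ B, tau p s b z := by
          rw [← tau_self (p := p) (s := s) b]
          exact Finset.single_le_sum (f := fun z => tau p s b z) (fun z _ => hτ b z) hb
        nlinarith [hXM b]
      · rw [ind_pos hb, one_mul]
        refine mul_le_mul_of_nonneg_left ?_ (phi_nonneg h0 h1 _)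
        refine le_trans ?_ (off_avg hp0 hp1 h0 h1 b B)
        refine sub_le_sub_left ?_ _
        rw [Finset.mul_sum]
        refine Finset.sum_le_sum fun z _ => ?_
        rw [mul_comm M]
        exact mul_le_mul (tau_off_le hp0 hp1' A b z) (hXM z) (hX0 z) (hτ b z)
  refine le_trans ?_ step2
  have step3 : E p sA (fun S => phi h (K S a).card * (X b - M * ∑ z ∈ K S a, tau p s b z)) =
      X a * X b - M * ∑ z, tau p s b z * E p sA (fun S => ind (R S a z) * phi h (K S a).card) := by
    have : ∀ S : Finset (Sym2 V), phi h (K S a).card * (X b - M * ∑ z ∈ K S a, tau p s b z) =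
        phi h (K S a).card * X b - M * ∑ z, tau p s b z * (ind (R S a z) * phi h (K S a).card) := by
      intro S
      have e : ∑ z ∈ K S a, tau p s b z = ∑ z, tau p s b z * ind (R S a z) := by
        unfold K ind
        rw [Finset.sum_filter]
        refine Finset.sum_congr rfl fun z _ => ?_
        split_ifs <;> simp
      rw [e, mul_sub, Finset.mul_sum, Finset.mul_sum, Finset.mul_sum]
      congr 1
      refine Finset.sum_congr rfl fun z _ => ?_
      ring
    simp only [this]
    rw [E_sub, E_mul_right, E_mul, E_sum]
    simp only [E_mul]
    rfl
  rw [step3]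
  have step4 : ∑ z, tau p s b z * E p sA (fun S => ind (R S a z) * phi h (K S a).card) ≤
      M * tri p s a b := by
    rw [← tri_eq, Finset.mul_sum]
    refine Finset.sum_le_sum fun z _ => ?_
    have : E p sA (fun S => ind (R S a z) * phi h (K S a).card) ≤
        (∑ u, tau p s a u * tau p s u z) * M := by
      rw [← hM a]
      refine le_trans ?_ (tree_avg hp0 hp1 h0 h1 hs a z)
      rw [hsA]
      refine le_trans (le_of_eq (E_restrict p s (offE A)
        (fun S => ind (R S a z) * phi h (K S a).card)).symm) ?_
      refine E_mono hp0 hp1' fun S _ => ?_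
      refine mul_le_mul (ind_mono (R_mono (Finset.filter_subset _ _))) ?_ (phi_nonneg h0 h1 _)
        (ind_nonneg _)
      exact phi_mono h0 h1 (Finset.card_le_card (K_mono (Finset.filter_subset _ _) _))
    calc _ ≤ tau p s b z * ((∑ u, tau p s a u * tau p s u z) * M) :=
          mul_le_mul_of_nonneg_left this (hτ b z)
      _ = _ := by ring
  have sa0 : 0 ≤ ∑ z ∈ A, tau p s a z := Finset.sum_nonneg fun z _ => hτ a z
  have sb0 : 0 ≤ ∑ z ∈ A, tau p s b z := Finset.sum_nonneg fun z _ => hτ b z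
  have q1 : X a * (M - M * ∑ z ∈ A, tau p s b z) ≤ X a * X b :=
    mul_le_mul_of_nonneg_left (hXl b) (hX0 a)
  have q2 : X a * (M * ∑ z ∈ A, tau p s b z) ≤ M * (M * ∑ z ∈ A, tau p s b z) :=
    mul_le_mul_of_nonneg_right (hXM a) (by positivity)
  have q3 := mul_le_mul_of_nonneg_left (hXl a) hM0
  have q4 := mul_le_mul_of_nonneg_left step4 hM0
  nlinarith

lemma D_lower (hp0 : 0 ≤ p) (hp1 : p ≤ 1 / 2) (h0 : 0 ≤ h) (h1 : h ≤ 1) (hs : Hom s)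
    (w a b : V) (M X : ℝ) (hM : ∀ x, EK p s (phi h) x = M) (hX : ∀ x, EK p s (xw h) x = X) :
    M ^ 2 * X * (1 - tri p s a b - tri p s w a - tri p s w b) ≤
      ∑ x, E h Finset.univ (fun g => E p s (fun S => ind (Dev g x w a b S))) := by
  have hp1' : p ≤ 1 := by linarith
  have hτ : ∀ x y, 0 ≤ tau p s x y := tau_nonneg hp0 hp1'
  have e1 : ∑ x, E h Finset.univ (fun g => E p s (fun S => ind (Dev g x w a b S))) =
      E p s (fun S => xw h (K S w).card * (ind (a ∉ K S w) * ind (b ∉ K S w) *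
        (ind (b ∉ K S a) * (phi h (K S a).card * phi h (K S b).card)))) := by
    simp only [← E_comm (p := p)]
    rw [← E_sum]
    refine E_congr fun S _ => ?_
    have e2 : ∀ x, E h Finset.univ (fun g => ind (Dev g x w a b S)) = ind (R S w x) *
        E h Finset.univ (fun g => ind (¬ RG S w g ∧ RG S a g ∧ RG S b g ∧ ¬ R S a b)) := by
      intro x
      rw [← E_mul]
      refine E_congr fun g _ => ?_
      rw [← ind_and]
      exact ind_congr (by unfold Dev; rw [R_comm])
    simp only [e2]
    rw [← Finset.sum_mul, ← card_K_eq]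
    unfold xw
    rw [mul_assoc]
    congr 1
    by_cases ha : a ∈ K S w
    · rw [ind_neg (not_not.2 ha), zero_mul, zero_mul, mul_zero]
      rw [← E_const h (Finset.univ : Finset V) 0]
      refine E_congr fun g _ => ind_neg ?_
      rintro ⟨q1, q2, -, -⟩
      exact q1 (RG_of_R (mem_K.1 ha) q2)
    by_cases hb : b ∈ K S w
    · rw [ind_neg (not_not.2 hb), mul_zero, zero_mul, mul_zero]
      rw [← E_const h (Finset.univ : Finset V) 0]
      refine E_congr fun g _ => ind_neg ?_
      rintro ⟨q1, -, q2, -⟩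
      exact q1 (RG_of_R (mem_K.1 hb) q2)
    by_cases hab : b ∈ K S a
    · rw [ind_neg (P := b ∉ K S a) (not_not.2 hab), zero_mul, mul_zero, mul_zero]
      rw [← E_const h (Finset.univ : Finset V) 0]
      refine E_congr fun g _ => ind_neg ?_
      rintro ⟨-, -, -, q1⟩
      exact q1 (mem_K.1 hab)
    rw [ind_pos ha, ind_pos hb, ind_pos hab, one_mul, one_mul, one_mul]
    have hd : ∀ u v : V, v ∉ K S u → Disjoint (K S u) (K S v) := by
      intro u v huv
      rw [Finset.disjoint_left]
      intro z hz hz'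
      exact huv (mem_K.2 (R_trans (mem_K.1 hz) (R_symm (mem_K.1 hz'))))
    rw [← avg_three (hd _ _ ha) (hd _ _ hb) (hd _ _ hab)]
    refine E_congr fun g _ => ?_
    rw [← ind_and, ← ind_and]
    refine ind_congr ?_
    rw [RG_iff_K, RG_iff_K, RG_iff_K, not_not]
    have : ¬ R S a b := fun h => hab (mem_K.2 h)
    tauto
  rw [e1]
  have step : E p s (fun S => xw h (K S w).card * (M ^ 2 * (1 - ∑ z ∈ K S w, tau p s a z -
      ∑ z ∈ K S w, tau p s b z - tri p s a b))) ≤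
      E p s (fun S => xw h (K S w).card * (ind (a ∉ K S w) * ind (b ∉ K S w) *
        (ind (b ∉ K S a) * (phi h (K S a).card * phi h (K S b).card)))) := by
    have := explore_ge hp0 hp1' s {w}
      (fun A S => xw h A.card * (ind (a ∉ A) * ind (b ∉ A) * (ind (b ∉ K S a) *
        (phi h (K S a).card * phi h (K (off S (K S a)) b).card))))
      (fun A => xw h A.card * (M ^ 2 * (1 - ∑ z ∈ A, tau p s a z -
        ∑ z ∈ A, tau p s b z - tri p s a b))) ?_
    · simp only [← K_eq_Cl] at this
      refine this.trans (le_of_eq ?_)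
      refine E_congr fun S _ => ?_
      congr 1
      by_cases ha : a ∈ K S w
      · rw [ind_neg (not_not.2 ha), zero_mul, zero_mul, zero_mul]
      by_cases hb : b ∈ K S w
      · rw [ind_neg (P := b ∉ K S w) (not_not.2 hb), mul_zero, zero_mul, zero_mul]
      have ka : K (off S (K S w)) a = K S a := by
        have := K_off (S := S) (g := {w}) (y := a); rw [← K_eq_Cl] at this; exact this ha
      have kb : K (off S (K S w)) b = K S b := by
        have := K_off (S := S) (g := {w}) (y := b); rw [← K_eq_Cl] at this; exact this hb
      by_cases hab : b ∈ K S a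
      · rw [ka, ind_neg (P := b ∉ K S a) (not_not.2 hab), zero_mul, zero_mul]
      have kb2 : K (off (off S (K S w)) (K (off S (K S w)) a)) b = K S b := by
        have := K_off (S := off S (K S w)) (g := {a}) (y := b)
        rw [← K_eq_Cl] at this
        rw [this (by rw [ka]; exact hab), kb]
      rw [kb2, ka]
    · intro A
      rw [E_mul, E_mul]
      refine mul_le_mul_of_nonneg_left ?_ (xw_nonneg h1 _)
      have hone : ∀ c ∈ A, 1 ≤ ∑ z ∈ A, tau p s c z := by
        intro c hc
        rw [← tau_self (p := p) (s := s) c]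
        exact Finset.single_le_sum (f := fun z => tau p s c z) (fun z _ => hτ c z) hc
      have sa0 : 0 ≤ ∑ z ∈ A, tau p s a z := Finset.sum_nonneg fun z _ => hτ a z
      have sb0 : 0 ≤ ∑ z ∈ A, tau p s b z := Finset.sum_nonneg fun z _ => hτ b z
      have t0 : 0 ≤ tri p s a b := Finset.sum_nonneg fun u _ => Finset.sum_nonneg fun v _ =>
        mul_nonneg (mul_nonneg (hτ _ _) (hτ _ _)) (hτ _ _)
      by_cases ha : a ∈ A
      · rw [ind_neg (not_not.2 ha), zero_mul, zero_mul]
        refine mul_nonpos_of_nonneg_of_nonpos (sq_nonneg _) ?_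
        linarith [hone a ha]
      by_cases hb : b ∈ A
      · rw [ind_neg (P := b ∉ A) (not_not.2 hb), mul_zero, zero_mul]
        refine mul_nonpos_of_nonneg_of_nonpos (sq_nonneg _) ?_
        linarith [hone b hb]
      rw [ind_pos ha, ind_pos hb, one_mul, one_mul]
      exact Q_lower hp0 hp1 h0 h1 hs A a b M hM
  refine le_trans ?_ step
  have hsum : ∀ c, E p s (fun S => xw h (K S w).card * ∑ z ∈ K S w, tau p s c z) ≤
      X * tri p s w c := by
    intro c
    have e : ∀ S : Finset (Sym2 V), xw h (K S w).card * ∑ z ∈ K S w, tau p s c z =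
        ∑ z, tau p s c z * (ind (R S w z) * xw h (K S w).card) := by
      intro S
      have e : ∑ z ∈ K S w, tau p s c z = ∑ z, tau p s c z * ind (R S w z) := by
        unfold K ind
        rw [Finset.sum_filter]
        refine Finset.sum_congr rfl fun z _ => ?_
        split_ifs <;> simp
      rw [e, Finset.mul_sum]
      refine Finset.sum_congr rfl fun z _ => ?_
      ring
    simp only [e]
    rw [E_sum, ← tri_eq, Finset.mul_sum]
    refine Finset.sum_le_sum fun z _ => ?_
    rw [E_mul]
    calc _ ≤ tau p s c z * ((∑ u, tau p s w u * tau p s u z) * EK p s (xw h) w) :=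
          mul_le_mul_of_nonneg_left (three_avg hp0 hp1 h0 h1 hs w z) (hτ c z)
      _ = _ := by rw [hX]; ring
  have e4 : E p s (fun S => xw h (K S w).card * (M ^ 2 * (1 - ∑ z ∈ K S w, tau p s a z -
      ∑ z ∈ K S w, tau p s b z - tri p s a b))) =
      M ^ 2 * (X * (1 - tri p s a b)
        - E p s (fun S => xw h (K S w).card * ∑ z ∈ K S w, tau p s a z)
        - E p s (fun S => xw h (K S w).card * ∑ z ∈ K S w, tau p s b z)) := by
    rw [← hX w]
    unfold EK
    rw [← E_mul_right, ← E_sub, ← E_sub, ← E_mul]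
    refine E_congr fun S _ => ?_
    ring
  rw [e4]
  have qa := mul_le_mul_of_nonneg_left (hsum a) (sq_nonneg M)
  have qb := mul_le_mul_of_nonneg_left (hsum b) (sq_nonneg M)
  nlinarith

end lower
end Perc

namespace Perc
section mainineq
variable {V : Type*} [Fintype V] [DecidableEq V] [Nonempty V]
variable {p : ℝ} {s : Finset (Sym2 V)} {h : ℝ}

lemma trip_card (Ω : ℕ) (hdeg : ∀ a : V, (Finset.univ.filter fun b => s(a, b) ∈ s).card = Ω) :
    ((trip s).card : ℝ) = Fintype.card V * ((Ω : ℝ) * (Ω - 1)) := by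
  have e : trip s = (Finset.univ.sigma (fun w : V =>
      ((Finset.univ.filter fun b => s(w, b) ∈ s).offDiag))).map
        ⟨fun q => (q.1, q.2.1, q.2.2), by rintro ⟨a, b, c⟩ ⟨a', b', c'⟩ h; simp at h; grind⟩ := by
    ext ⟨w, a, b⟩
    simp [trip, Finset.mem_offDiag]
  rw [e, Finset.card_map, Finset.card_sigma]
  simp only [Finset.offDiag_card, hdeg, Finset.sum_const, Finset.card_univ, smul_eq_mul]
  push_cast [Nat.cast_sub (Nat.le_mul_self Ω)]
  ring

lemma MX (hp0 : 0 ≤ p) (hp1 : p ≤ 1 / 2) (h0 : 0 ≤ h) (h1 : h ≤ 1) (hs : Hom s)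
    (hloop : ∀ a : V, s(a, a) ∉ s) (Ω : ℕ)
    (hdeg : ∀ a : V, (Finset.univ.filter fun b => s(a, b) ∈ s).card = Ω)
    (a₀ : ℝ) (htri : ∀ x y, x ≠ y → tri p s x y ≤ a₀) (x : V) :
    p ^ 2 * ((Ω : ℝ) * (Ω - 1)) * (EK p s (phi h) x ^ 2 * EK p s (xw h) x * (1 - 3 * a₀)) ≤
      2 * EK p s (phi h) x := by
  have hp1' : p ≤ 1 := by linarith
  set M := EK p s (phi h) x with hMd
  set X := EK p s (xw h) x with hXd
  have hX0 : 0 ≤ X := E_nonneg hp0 hp1' fun S _ => xw_nonneg h1 _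
  have a1 : p ^ 2 * ∑ q ∈ trip s, ∑ x, E h Finset.univ (fun g =>
      E p s (fun S => ind (Dev g x q.1 q.2.1 q.2.2 S))) ≤ Fintype.card V * (2 * M) := by
    calc _ = ∑ x, E h Finset.univ (fun g => p ^ 2 * ∑ q ∈ trip s,
          E p s (fun S => ind (Dev g x q.1 q.2.1 q.2.2 S))) := by
          simp only [E_mul, E_sum]
          rw [← Finset.mul_sum, Finset.sum_comm]
      _ ≤ ∑ x, E h Finset.univ (fun g => 2 * taug p s x g) :=
          Finset.sum_le_sum fun x _ => E_mono h0 h1 fun g _ => Br_total hp0 hp1' g x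
      _ = ∑ x : V, 2 * M := by
          refine Finset.sum_congr rfl fun y _ => ?_
          rw [E_mul, avg_taug, hs p _ y x]
      _ = _ := by simp
  have a2 : ∑ q ∈ trip s, M ^ 2 * X * (1 - 3 * a₀) ≤ ∑ q ∈ trip s, ∑ x, E h Finset.univ (fun g =>
      E p s (fun S => ind (Dev g x q.1 q.2.1 q.2.2 S))) := by
    refine Finset.sum_le_sum fun q hq => ?_
    have hq' := (Finset.mem_filter.1 hq).2
    refine le_trans ?_ (D_lower hp0 hp1 h0 h1 hs q.1 q.2.1 q.2.2 M X (fun y => hs p _ y x)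
      (fun y => hs p _ y x))
    refine mul_le_mul_of_nonneg_left ?_ (by positivity)
    have b1 := htri _ _ hq'.2.2
    have b2 := htri q.1 q.2.1 (fun hh => hloop q.1 (by have := hq'.1; rwa [← hh] at this))
    have b3 := htri q.1 q.2.2 (fun hh => hloop q.1 (by have := hq'.2.1; rwa [← hh] at this))
    linarith
  rw [Finset.sum_const, nsmul_eq_mul, trip_card Ω hdeg] at a2
  have a3 := (mul_le_mul_of_nonneg_left a2 (sq_nonneg p)).trans a1
  have hV : (0 : ℝ) < Fintype.card V := by exact_mod_cast Fintype.card_pos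
  refine le_of_mul_le_mul_left ?_ hV
  refine le_trans (le_of_eq ?_) a3
  ring

lemma EK_phi_deriv (hp0 : 0 ≤ p) (hp1 : p ≤ 1) (x : V) (t : ℝ) (ht : t < 1) :
    HasDerivAt (fun t => EK p s (phi t) x) (EK p s (xw t) x / (1 - t)) t := by
  have e : EK p s (xw t) x / (1 - t) = EK p s (fun m => (m : ℝ) * (1 - t) ^ (m - 1)) x := by
    unfold EK
    rw [div_eq_mul_inv, ← E_mul_right]
    refine E_congr fun S _ => ?_
    have hm := card_K_pos S x
    obtain ⟨n, hn⟩ := Nat.exists_eq_add_of_le hm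
    have : (1 - t) ≠ 0 := by linarith
    simp only [xw]
    rw [hn, Nat.add_sub_cancel_left, pow_add, pow_one]
    field_simp
  rw [e]
  unfold EK E
  refine HasDerivAt.fun_sum fun S _ => ?_
  refine HasDerivAt.const_mul _ ?_
  unfold phi
  have h1 : HasDerivAt (fun t : ℝ => 1 - t) (-1) t := by
    simpa using (hasDerivAt_id t).const_sub 1
  have h2 := (h1.fun_pow (K S x).card).const_sub 1
  exact h2.congr_deriv (by ring)

/-- The magnetization bound. -/
lemma M_sq (hp0 : 0 ≤ p) (hp1 : p ≤ 1 / 2) (hs : Hom s)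
    (hloop : ∀ a : V, s(a, a) ∉ s) (Ω : ℕ) (hΩ : 2 ≤ Ω)
    (hdeg : ∀ a : V, (Finset.univ.filter fun b => s(a, b) ∈ s).card = Ω)
    (a₀ : ℝ) (ha₀ : a₀ ≤ 1 / 6) (hpΩ : 1 / 4 ≤ p * Ω)
    (htri : ∀ x y, x ≠ y → tri p s x y ≤ a₀) (x : V) (h0 : 0 ≤ h) (h1 : h ≤ 1 / 2) :
    EK p s (phi h) x ^ 2 ≤ 512 * h := by
  have hp1' : p ≤ 1 := by linarith
  have key : ∀ t : ℝ, 0 ≤ t → t ≤ 1 / 2 →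
      EK p s (phi t) x * EK p s (xw t) x ≤ 128 := by
    intro t t0 t1
    have hm := MX hp0 hp1 t0 (by linarith) hs hloop Ω hdeg a₀ htri x
    have hM0 : 0 ≤ EK p s (phi t) x := E_nonneg hp0 hp1' fun S _ => phi_nonneg t0 (by linarith) _
    have hX0 : 0 ≤ EK p s (xw t) x := E_nonneg hp0 hp1' fun S _ => xw_nonneg (by linarith) _
    set M := EK p s (phi t) x
    set X := EK p s (xw t) x
    have hΩ' : (2 : ℝ) ≤ Ω := by exact_mod_cast hΩ
    have c1 : 1 / 32 ≤ p ^ 2 * ((Ω : ℝ) * (Ω - 1)) := by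
      have : (p * Ω) ^ 2 / 2 ≤ p ^ 2 * ((Ω : ℝ) * (Ω - 1)) := by
        have : 0 ≤ p ^ 2 * Ω := by positivity
        nlinarith
      nlinarith
    rcases hM0.eq_or_lt with hz | hpos
    · rw [← hz]; norm_num
    have c2 : 1 / 32 * (M ^ 2 * X * (1 / 2)) ≤ 2 * M := by
      refine le_trans ?_ hm
      refine mul_le_mul c1 ?_ (by positivity) (by linarith)
      exact mul_le_mul_of_nonneg_left (by linarith) (by positivity)
    have : M * (M * X) ≤ M * 128 := by nlinarith
    exact le_of_mul_le_mul_left this hpos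
  -- monotonicity of `512 t - M(t)^2`
  have hder : ∀ t : ℝ, t ≤ 1 / 2 → HasDerivAt (fun t => 512 * t - EK p s (phi t) x ^ 2)
      (512 - 2 * EK p s (phi t) x * (EK p s (xw t) x / (1 - t))) t := by
    intro t t1
    have d1 := (EK_phi_deriv (s := s) hp0 hp1' x t (by linarith)).fun_pow 2
    have d2 := (hasDerivAt_id t).const_mul (512 : ℝ)
    have d3 := d2.sub d1
    exact d3.congr_deriv (by simp)
  have mono : MonotoneOn (fun t => 512 * t - EK p s (phi t) x ^ 2) (Set.Icc 0 (1 / 2)) := by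
    refine monotoneOn_of_deriv_nonneg (convex_Icc _ _)
      (fun t ht => (hder t ht.2).continuousAt.continuousWithinAt) ?_ ?_
    · intro t ht
      rw [interior_Icc] at ht
      exact (hder t ht.2.le).differentiableAt.differentiableWithinAt
    · intro t ht
      rw [interior_Icc] at ht
      rw [(hder t ht.2.le).deriv]
      have k := key t ht.1.le ht.2.le
      have : 2 * EK p s (phi t) x * (EK p s (xw t) x / (1 - t)) =
          2 * (EK p s (phi t) x * EK p s (xw t) x) / (1 - t) := by ring
      rw [this, sub_nonneg, div_le_iff₀ (by linarith [ht.2])]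
      nlinarith [ht.2]
  have := mono (Set.mem_Icc.2 ⟨le_rfl, by norm_num⟩) (Set.mem_Icc.2 ⟨h0, h1⟩) h0
  simp only at this
  have z : EK p s (phi 0) x = 0 := by
    unfold EK
    refine (E_congr fun S _ => ?_).trans (E_const p s 0)
    simp [phi]
  rw [z] at this
  nlinarith

end mainineq
end Perc

namespace Perc
section analysis
variable {V : Type*} [Fintype V] [DecidableEq V] [Nonempty V]
variable {p : ℝ} {s : Finset (Sym2 V)} {h : ℝ}

/-- Truncated susceptibility. -/
def fn (s : Finset (Sym2 V)) (x : V) (n p : ℝ) : ℝ := EK p s (fun m => min (m : ℝ) n) x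

/-- Its derivative. -/
def fd (s : Finset (Sym2 V)) (x : V) (n p : ℝ) : ℝ :=
  ∑ e ∈ s, E p s (fun S => min ((K (insert e S) x).card : ℝ) n -
        min ((K (S.erase e) x).card : ℝ) n)

lemma fn_deriv (x : V) (n p : ℝ) : HasDerivAt (fn s x n) (fd s x n p) p :=
  E_deriv s (fun S => min ((K S x).card : ℝ) n) p

lemma fd_nonneg (x : V) (n : ℝ) (hp0 : 0 ≤ p) (hp1 : p ≤ 1) : 0 ≤ fd s x n p := by
  refine Finset.sum_nonneg fun e _ => E_nonneg hp0 hp1 fun S _ => ?_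
  rw [sub_nonneg]
  refine min_le_min_right _ ?_
  exact_mod_cast Finset.card_le_card
    (K_mono ((Finset.erase_subset _ _).trans (Finset.subset_insert _ _)) x)

lemma fn_mono (x : V) (n : ℝ) : MonotoneOn (fn s x n) (Set.Icc 0 1) := by
  refine monotoneOn_of_deriv_nonneg (convex_Icc _ _)
    (fun t ht => (fn_deriv x n t).continuousAt.continuousWithinAt)
    (fun t ht => (fn_deriv x n t).differentiableAt.differentiableWithinAt) ?_
  intro t ht
  rw [interior_Icc] at ht
  rw [(fn_deriv x n t).deriv]
  exact fd_nonneg x n ht.1.le ht.2.le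

lemma one_le_fn (x : V) {n : ℝ} (hn : 1 ≤ n) (hp0 : 0 ≤ p) (hp1 : p ≤ 1) : 1 ≤ fn s x n p := by
  rw [← E_const p s 1]
  refine E_mono hp0 hp1 fun S _ => ?_
  refine le_min ?_ hn
  exact_mod_cast card_K_pos S x

lemma inv_fn_mono (hs : Hom s) (hloop : ∀ a : V, s(a, a) ∉ s) (Ω : ℕ)
    (hdeg : ∀ a : V, (Finset.univ.filter fun b => s(a, b) ∈ s).card = Ω) {n : ℝ} (hn : 1 ≤ n)
    (x : V) : MonotoneOn (fun t => (fn s x n t)⁻¹ + 2 * Ω * t) (Set.Icc 0 (1 / 2)) := by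
  have hpos : ∀ t ∈ Set.Icc (0 : ℝ) (1 / 2), 1 ≤ fn s x n t := fun t ht =>
    one_le_fn x hn ht.1 (by linarith [ht.2])
  have hder : ∀ t ∈ Set.Icc (0 : ℝ) (1 / 2), HasDerivAt (fun t => (fn s x n t)⁻¹ + 2 * Ω * t)
      (-fd s x n t / fn s x n t ^ 2 + 2 * Ω) t := by
    intro t ht
    have hp := hpos t ht
    have d1 := (fn_deriv (s := s) x n t).fun_inv (by linarith)
    have d2 := (hasDerivAt_id t).const_mul (2 * Ω : ℝ)
    exact (d1.add d2).congr_deriv (by simp)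
  refine monotoneOn_of_deriv_nonneg (convex_Icc _ _)
    (fun t ht => (hder t ht).continuousAt.continuousWithinAt)
    (fun t ht => (hder t (interior_subset ht)).differentiableAt.differentiableWithinAt) ?_
  intro t ht
  have ht' := interior_subset ht
  rw [(hder t ht').deriv]
  have hp := hpos t ht'
  have hd := f_deriv_le (p := t) ht'.1 (by linarith [ht'.2]) hs hloop Ω hdeg (by linarith : 0 ≤ n) x
  change (1 - t) * fd s x n t ≤ Ω * fn s x n t ^ 2 at hd
  have hd0 := fd_nonneg (s := s) x n ht'.1 (by linarith [ht'.2])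
  have : fd s x n t / fn s x n t ^ 2 ≤ 2 * Ω := by
    rw [div_le_iff₀ (by positivity)]
    nlinarith [ht'.2]
  rw [neg_div]; linarith

lemma fn_zero (x : V) {n : ℝ} (hn : 1 ≤ n) : fn s x n 0 = 1 := by
  unfold fn EK E
  rw [Finset.sum_eq_single ∅]
  · have : (K ∅ x).card = 1 := by
      rw [Finset.card_eq_one]
      refine ⟨x, ?_⟩
      ext y
      rw [mem_K, Finset.mem_singleton]
      refine ⟨fun h => ?_, fun h => h ▸ R_refl _ _⟩
      refine R_induct (P := fun z => y = z) rfl ?_ h |>.trans rfl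
      intro a b hab
      simp at hab
    simp [this, hn]
  · intro S _ hS
    have : S.card ≠ 0 := by simpa using hS
    simp [this]
  · simp

lemma tau_edge (hp0 : 0 ≤ p) (hp1 : p ≤ 1) {x y : V} (hxy : s(x, y) ∈ s) : p ≤ tau p s x y := by
  have h1 := E_open p hxy (fun _ => (1 : ℝ))
  have h2 : E p s (fun S => ind (s(x, y) ∉ S) * 1) = 1 - E p s (fun S => ind (s(x, y) ∈ S) * 1) := by
    have h3 : E p s (fun S => (1 : ℝ) - ind (s(x, y) ∈ S) * 1) =
        1 - E p s (fun S => ind (s(x, y) ∈ S) * 1) := by rw [E_sub, E_const]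
    rw [← h3]
    exact E_congr fun S _ => by rw [ind_not]; ring
  rw [h2] at h1
  have h4 : E p s (fun S => ind (s(x, y) ∈ S) * 1) = p := by linarith
  calc p = E p s (fun S => ind (s(x, y) ∈ S) * 1) := h4.symm
    _ ≤ tau p s x y := by
      refine E_mono hp0 hp1 fun S _ => ?_
      rw [mul_one]
      exact ind_mono R_edge

lemma tau_le_tri (hp0 : 0 ≤ p) (hp1 : p ≤ 1) (x y : V) : tau p s x y ≤ tri p s x y := by
  have hτ : ∀ x y, 0 ≤ tau p s x y := tau_nonneg hp0 hp1
  have t0 : ∀ u v, 0 ≤ tau p s x u * tau p s u v * tau p s v y := fun u v =>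
    mul_nonneg (mul_nonneg (hτ _ _) (hτ _ _)) (hτ _ _)
  calc tau p s x y = tau p s x x * tau p s x x * tau p s x y := by rw [tau_self]; ring
    _ ≤ ∑ v, tau p s x x * tau p s x v * tau p s v y :=
        Finset.single_le_sum (f := fun v => tau p s x x * tau p s x v * tau p s v y)
          (fun v _ => t0 x v) (Finset.mem_univ x)
    _ ≤ tri p s x y :=
        Finset.single_le_sum (f := fun u => ∑ v, tau p s x u * tau p s u v * tau p s v y)
          (fun u _ => Finset.sum_nonneg fun v _ => t0 u v) (Finset.mem_univ x)

lemma phi_lower {k : ℝ} (hk : 1 ≤ k) (m : ℕ) : min (m : ℝ) k ≤ 2 * k * phi k⁻¹ m := by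
  have hk0 : 0 < k := by linarith
  set h := k⁻¹ with hh
  have h0 : 0 < h := by positivity
  have h1 : h ≤ 1 := inv_le_one_of_one_le₀ hk
  have hkh : k * h = 1 := mul_inv_cancel₀ hk0.ne'
  have b1 : 1 + m * h ≤ (1 + h) ^ m := one_add_mul_le_pow (by linarith) m
  have b2 : (1 - h) ^ m * (1 + h) ^ m ≤ 1 := by
    rw [← mul_pow]
    exact pow_le_one₀ (by nlinarith) (by nlinarith)
  have b0 : 0 ≤ (1 - h) ^ m := pow_nonneg (by linarith) _
  have b3 : (1 - h) ^ m * (1 + m * h) ≤ 1 := le_trans (mul_le_mul_of_nonneg_left b1 b0) b2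
  have b4 : (1 - h) ^ m ≤ 1 := pow_le_one₀ (by linarith) (by linarith)
  unfold phi
  set q := (1 - h) ^ m
  have hm : (0 : ℝ) ≤ m := Nat.cast_nonneg m
  rcases le_total (m : ℝ) k with hc | hc
  · rw [min_eq_left hc]
    have hmh : (m : ℝ) * h ≤ 1 := by rw [← hkh]; exact mul_le_mul_of_nonneg_right hc h0.le
    have hmh0 : 0 ≤ (m : ℝ) * h := by positivity
    have : (m : ℝ) * h ≤ 2 * (1 - q) := by
      nlinarith [mul_nonneg (sub_nonneg.2 hmh) (sub_nonneg.2 b4)]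
    calc (m : ℝ) = k * (m * h) := by rw [mul_comm (m : ℝ), ← mul_assoc, hkh, one_mul]
      _ ≤ k * (2 * (1 - q)) := mul_le_mul_of_nonneg_left this hk0.le
      _ = _ := by ring
  · rw [min_eq_right hc]
    have hmh : 1 ≤ (m : ℝ) * h := by rw [← hkh]; exact mul_le_mul_of_nonneg_right hc h0.le
    have : 1 ≤ 2 * (1 - q) := by nlinarith
    nlinarith

lemma fk_crit (hp0 : 0 ≤ p) (hp1 : p ≤ 1 / 2) (hs : Hom s)
    (hloop : ∀ a : V, s(a, a) ∉ s) (Ω : ℕ) (hΩ : 2 ≤ Ω)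
    (hdeg : ∀ a : V, (Finset.univ.filter fun b => s(a, b) ∈ s).card = Ω)
    (a₀ : ℝ) (ha₀ : a₀ ≤ 1 / 6) (hpΩ : 1 / 4 ≤ p * Ω)
    (htri : ∀ x y, x ≠ y → tri p s x y ≤ a₀) (x : V) {k : ℝ} (hk : 1 ≤ k) :
    fn s x k p ≤ 46 * Real.sqrt k := by
  have hp1' : p ≤ 1 := by linarith
  have hf1 := one_le_fn (s := s) x hk hp0 hp1'
  refine le_of_sq_le_sq ?_ (by positivity)
  rw [mul_pow, Real.sq_sqrt (by linarith)]
  rcases le_total k 2 with h2 | h2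
  · have : fn s x k p ≤ k := by
      rw [← E_const p s k]
      exact E_mono hp0 hp1' fun S _ => by rw [E_const]; exact min_le_right _ _
    nlinarith
  · have h3 : fn s x k p ≤ 2 * k * EK p s (phi k⁻¹) x := by
      unfold fn EK
      rw [← E_mul]
      exact E_mono hp0 hp1' fun S _ => phi_lower hk _
    have h4 := M_sq hp0 hp1 hs hloop Ω hΩ hdeg a₀ ha₀ hpΩ htri x (h := k⁻¹) (by positivity)
      (by rw [inv_le_comm₀ (by linarith) (by norm_num)]; linarith)
    have hk0 : 0 < k := by linarith
    calc fn s x k p ^ 2 ≤ (2 * k * EK p s (phi k⁻¹) x) ^ 2 := by gcongr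
      _ = 4 * k ^ 2 * EK p s (phi k⁻¹) x ^ 2 := by ring
      _ ≤ 4 * k ^ 2 * (512 * k⁻¹) := by gcongr
      _ = 2048 * k := by field_simp; ring
      _ ≤ _ := by nlinarith

lemma core (hs : Hom s) (hloop : ∀ a : V, s(a, a) ∉ s) (Ω : ℕ) (hΩ : 1 ≤ Ω)
    (hdeg : ∀ a : V, (Finset.univ.filter fun b => s(a, b) ∈ s).card = Ω)
    (x : V) (pc : ℝ) (hpc0 : 0 ≤ pc) (hpc1 : pc ≤ 1) (c : ℝ)
    (hc : EK pc s (fun m => (m : ℝ)) x = c) (hc8 : 8 ≤ c)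
    (a₀ : ℝ) (ha₀ : a₀ ≤ 1 / 8) (htri : ∀ x y, x ≠ y → tri pc s x y ≤ a₀)
    (ε p : ℝ) (hp : p = pc + (Ω : ℝ)⁻¹ * ε) (hp0 : 0 ≤ p) (k : ℝ) (hk : 1 ≤ k)
    (hsmall : Real.sqrt k * (c⁻¹ + 2 * |ε|) ≤ 1 / 500) :
    28 / 65536 / Real.sqrt k ≤ E p s (fun S => ind (k ≤ ((K S x).card : ℝ))) ∧
      E p s (fun S => ind (k ≤ ((K S x).card : ℝ))) ≤ 92 / Real.sqrt k := by
  have hΩ' : (1 : ℝ) ≤ Ω := by exact_mod_cast hΩ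
  -- a neighbour
  have hpc8 : pc ≤ 1 / 8 := by
    have hne : (Finset.univ.filter fun b => s(x, b) ∈ s).Nonempty := by
      rw [← Finset.card_pos, hdeg]; exact hΩ
    obtain ⟨y, hy⟩ := hne
    have hy' := (Finset.mem_filter.1 hy).2
    have hxy : x ≠ y := fun h => hloop x (by rwa [← h] at hy')
    exact ((tau_edge hpc0 hpc1 hy').trans (tau_le_tri hpc0 hpc1 x y)).trans
      ((htri x y hxy).trans ha₀)
  set N : ℝ := (Fintype.card V : ℝ) with hN
  have hN1 : 1 ≤ N := by
    have : 1 ≤ Fintype.card V := Fintype.card_pos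
    rw [hN]; exact_mod_cast this
  have hchi : ∀ t, fn s x N t = EK t s (fun m => (m : ℝ)) x := by
    intro t
    refine E_congr fun S _ => ?_
    refine min_eq_left ?_
    rw [hN]; exact_mod_cast Finset.card_le_univ (K S x)
  have hfc : fn s x N pc = c := by rw [hchi, hc]
  have mχ := inv_fn_mono hs hloop Ω hdeg hN1 x
  have hk0 : 0 < k := by linarith
  have hsk : 1 ≤ Real.sqrt k := Real.one_le_sqrt.2 hk
  have hε0 := abs_nonneg ε
  have hci : 0 < c⁻¹ := by positivity
  have hpΩ : 1 / 4 ≤ pc * Ω := by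
    have := mχ (Set.mem_Icc.2 ⟨le_rfl, by norm_num⟩) (Set.mem_Icc.2 ⟨hpc0, by linarith⟩) hpc0
    simp only [fn_zero x hN1, hfc] at this
    have : c⁻¹ ≤ 1 / 8 := by rw [inv_le_comm₀ (by linarith) (by norm_num)]; linarith
    linarith
  have hΩ2 : 2 ≤ Ω := by
    by_contra hcon
    have : Ω = 1 := by omega
    rw [this] at hpΩ
    norm_num at hpΩ
    linarith
  have hεk : Real.sqrt k * |ε| ≤ 1 / 1000 := by
    have : 0 ≤ Real.sqrt k * c⁻¹ := by positivity
    nlinarith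
  have hε1 : |ε| ≤ 1 / 1000 := by nlinarith
  have hΩp : Ω * (p - pc) = ε := by
    rw [hp]; field_simp; ring
  have hp2 : p ≤ 1 / 2 := by
    have h1 : (Ω : ℝ)⁻¹ * ε ≤ 1 * |ε| := by
      refine (mul_le_mul_of_nonneg_left (le_abs_self ε) (by positivity)).trans ?_
      exact mul_le_mul_of_nonneg_right (inv_le_one_of_one_le₀ hΩ') hε0
    rw [hp]; linarith
  have hp1 : p ≤ 1 := by linarith
  have hfk : fn s x k p ≤ 92 * Real.sqrt k := by
    have hcr := fk_crit hpc0 (by linarith) hs hloop Ω hΩ2 hdeg a₀ (by linarith) hpΩ htri x hk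
    rcases le_total p pc with hle | hle
    · have := fn_mono (s := s) x k (Set.mem_Icc.2 ⟨hp0, hp1⟩) (Set.mem_Icc.2 ⟨hpc0, hpc1⟩) hle
      linarith
    · have := inv_fn_mono hs hloop Ω hdeg hk x (Set.mem_Icc.2 ⟨hpc0, by linarith⟩)
        (Set.mem_Icc.2 ⟨hp0, hp2⟩) hle
      simp only at this
      have hfpos := one_le_fn (s := s) x hk hpc0 hpc1
      have hfpos' := one_le_fn (s := s) x hk hp0 hp1
      have h1 : (46 * Real.sqrt k)⁻¹ ≤ (fn s x k pc)⁻¹ := inv_anti₀ (by linarith) hcr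
      have h2 : (92 * Real.sqrt k)⁻¹ ≤ (fn s x k p)⁻¹ := by
        have e1 : (46 * Real.sqrt k)⁻¹ = (Real.sqrt k)⁻¹ / 46 := by rw [mul_inv]; ring
        have e2 : (92 * Real.sqrt k)⁻¹ = (Real.sqrt k)⁻¹ / 92 := by rw [mul_inv]; ring
        have e3 : |ε| ≤ (Real.sqrt k)⁻¹ / 1000 := by
          rw [div_eq_mul_inv, inv_mul_eq_div, le_div_iff₀ (by positivity)]
          linarith
        have e4 := le_abs_self ε
        have e5 : 0 < (Real.sqrt k)⁻¹ := by positivity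
        rw [e1] at h1
        rw [e2]
        nlinarith
      exact (inv_le_inv₀ (by positivity) (by linarith)).1 h2
  constructor
  · -- lower bound
    set n : ℝ := 65536 * k with hn
    have hsn : Real.sqrt n = 256 * Real.sqrt k := by
      rw [hn, Real.sqrt_mul (by norm_num)]
      congr 1
      rw [show (65536 : ℝ) = 256 ^ 2 by norm_num]
      exact Real.sqrt_sq (by norm_num)
    have hχp1 := one_le_fn (s := s) x hN1 hp0 hp1
    have hχinv : (fn s x N p)⁻¹ ≤ c⁻¹ + 2 * |ε| := by
      rcases le_total p pc with hle | hle
      · have := mχ (Set.mem_Icc.2 ⟨hp0, hp2⟩) (Set.mem_Icc.2 ⟨hpc0, by linarith⟩) hle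
        simp only [hfc] at this
        have := neg_le_abs ε
        nlinarith
      · have := fn_mono (s := s) x N (Set.mem_Icc.2 ⟨hpc0, hpc1⟩) (Set.mem_Icc.2 ⟨hp0, hp1⟩) hle
        rw [hfc] at this
        have := inv_anti₀ (by linarith) this
        linarith
    have hχp : Real.sqrt n / 2 ≤ fn s x N p := by
      rw [hsn]
      have h1 : Real.sqrt k * (fn s x N p)⁻¹ ≤ 1 / 500 :=
        (mul_le_mul_of_nonneg_left hχinv (by positivity)).trans hsmall
      rw [← div_eq_mul_inv, div_le_iff₀ (by linarith)] at h1
      linarith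
    obtain ⟨p', hp', hχ'⟩ : ∃ p' ∈ Set.Icc 0 p, fn s x N p' = Real.sqrt n / 2 := by
      have hcont : ContinuousOn (fn s x N) (Set.Icc 0 p) := fun t _ =>
        (fn_deriv x N t).continuousAt.continuousWithinAt
      have := intermediate_value_Icc hp0 hcont
      refine this (Set.mem_Icc.2 ⟨?_, hχp⟩)
      rw [fn_zero x hN1, hsn]; linarith
    have hp'1 : p' ≤ 1 / 2 := hp'.2.trans hp2
    have hn0 : 0 < n := by positivity
    have hsq : Real.sqrt n ^ 2 = n := Real.sq_sqrt hn0.le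
    have hsn0 : 0 < Real.sqrt n := by positivity
    have h2m := second_moment hp'.1 hp'1 hs x
    have hfn' : 15 / 32 * Real.sqrt n ≤ fn s x n p' := by
      have h3 : EK p' s (fun m => (m : ℝ)) x - (4 * n)⁻¹ * EK p' s (fun m => (m : ℝ) ^ 2) x ≤
          fn s x n p' := by
        unfold fn EK
        rw [← E_mul, ← E_sub]
        refine E_mono hp'.1 (by linarith) fun S _ => ?_
        show ((K S x).card : ℝ) - (4 * n)⁻¹ * ((K S x).card : ℝ) ^ 2 ≤ min ((K S x).card : ℝ) n
        set m : ℝ := ((K S x).card : ℝ)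
        refine le_min ?_ ?_
        · have : 0 ≤ (4 * n)⁻¹ * m ^ 2 := by positivity
          linarith
        · have : m - n ≤ (4 * n)⁻¹ * m ^ 2 := by
            rw [inv_mul_eq_div, le_div_iff₀ (by positivity)]
            nlinarith [sq_nonneg (m - 2 * n)]
          linarith
      have h4 : (4 * n)⁻¹ * EK p' s (fun m => (m : ℝ) ^ 2) x ≤ (4 * n)⁻¹ * (Real.sqrt n / 2) ^ 3 := by
        refine mul_le_mul_of_nonneg_left ?_ (by positivity)
        rw [← hχ', hchi]; exact h2m
      have h5 : (4 * n)⁻¹ * (Real.sqrt n / 2) ^ 3 = Real.sqrt n / 32 := by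
        rw [inv_mul_eq_div, div_eq_iff (by positivity), ← hsq]
        rw [Real.sqrt_sq hsn0.le]
        ring
      rw [← hchi, hχ'] at h3
      linarith
    have hfnp : 120 * Real.sqrt k ≤ fn s x n p := by
      have := fn_mono (s := s) x n (Set.mem_Icc.2 ⟨hp'.1, by linarith⟩) (Set.mem_Icc.2 ⟨hp0, hp1⟩) hp'.2
      rw [hsn] at hfn'
      linarith
    have hcmp : fn s x n p ≤ fn s x k p + n * E p s (fun S => ind (k ≤ ((K S x).card : ℝ))) := by
      unfold fn EK
      rw [← E_mul, ← E_add]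
      refine E_mono hp0 hp1 fun S _ => ?_
      show min ((K S x).card : ℝ) n ≤ min ((K S x).card : ℝ) k + _
      by_cases hkm : k ≤ ((K S x).card : ℝ)
      · rw [ind_pos hkm, min_eq_right hkm]
        have := min_le_right ((K S x).card : ℝ) n
        linarith
      · rw [ind_neg hkm]
        push Not at hkm
        rw [min_eq_left hkm.le]
        have := min_le_left ((K S x).card : ℝ) n
        linarith
    have h28 : 28 * Real.sqrt k ≤ n * E p s (fun S => ind (k ≤ ((K S x).card : ℝ))) := by linarith
    rw [div_le_iff₀ (by positivity)]
    have hkk : Real.sqrt k * Real.sqrt k = k := Real.mul_self_sqrt hk0.le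
    set P := E p s (fun S => ind (k ≤ ((K S x).card : ℝ)))
    have h6 : Real.sqrt k * 28 ≤ Real.sqrt k * (65536 * (P * Real.sqrt k)) := by
      calc Real.sqrt k * 28 = 28 * Real.sqrt k := by ring
        _ ≤ n * P := h28
        _ = 65536 * (Real.sqrt k * Real.sqrt k) * P := by rw [hkk]
        _ = _ := by ring
    have h7 := le_of_mul_le_mul_left h6 (by linarith)
    linarith
  · -- upper bound
    have h1 : k * E p s (fun S => ind (k ≤ ((K S x).card : ℝ))) ≤ fn s x k p := by
      unfold fn EK
      rw [← E_mul]
      refine E_mono hp0 hp1 fun S _ => ?_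
      show _ ≤ min ((K S x).card : ℝ) k
      by_cases hkm : k ≤ ((K S x).card : ℝ)
      · rw [ind_pos hkm, min_eq_right hkm, mul_one]
      · rw [ind_neg hkm, mul_zero]
        exact le_min (Nat.cast_nonneg _) hk0.le
    rw [le_div_iff₀ (by positivity)]
    have hkk : Real.sqrt k * Real.sqrt k = k := Real.mul_self_sqrt hk0.le
    set P := E p s (fun S => ind (k ≤ ((K S x).card : ℝ)))
    have h6 : Real.sqrt k * (P * Real.sqrt k) ≤ Real.sqrt k * 92 := by
      calc Real.sqrt k * (P * Real.sqrt k) = (Real.sqrt k * Real.sqrt k) * P := by ring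
        _ = k * P := by rw [hkk]
        _ ≤ 92 * Real.sqrt k := h1.trans hfk
        _ = _ := by ring
    exact le_of_mul_le_mul_left h6 (by linarith)

end analysis
end Perc

namespace Perc
section translate
variable {V : Type*} [Fintype V] [DecidableEq V]

/-- The finite set of bonds. -/
def eg (G : SimpleGraph V) : Finset (Sym2 V) := Finset.univ.filter fun e => e ∈ G.edgeSet

/-- Configuration attached to a set of bonds. -/
def toConf (G : SimpleGraph V) (S : Finset (Sym2 V)) : Percolation.Config G :=
  fun e => decide ((e : Sym2 V) ∈ S)

/-- The action on bonds of a permutation of the vertices. -/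
def bondPerm (σ : V ≃ V) : Equiv.Perm (Sym2 V) where
  toFun := Sym2.map σ
  invFun := Sym2.map σ.symm
  left_inv e := by induction e with | _ a b => simp
  right_inv e := by induction e with | _ a b => simp

/-- The set of occupied bonds. -/
def conf (G : SimpleGraph V) (ω : Percolation.Config G) : Finset (Sym2 V) :=
  Finset.univ.filter fun e => ∃ h : e ∈ G.edgeSet, ω ⟨e, h⟩ = true

lemma mem_eg {G : SimpleGraph V} {e : Sym2 V} : e ∈ eg G ↔ e ∈ G.edgeSet := by simp [eg]

lemma mem_conf {G : SimpleGraph V} {ω : Percolation.Config G} {e : Sym2 V} :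
    e ∈ conf G ω ↔ ∃ h : e ∈ G.edgeSet, ω ⟨e, h⟩ = true := by simp [conf]

lemma conf_subset (G : SimpleGraph V) (ω : Percolation.Config G) : conf G ω ⊆ eg G := by
  intro e he
  obtain ⟨h, _⟩ := mem_conf.1 he
  exact mem_eg.2 h

lemma weight_eq (G : SimpleGraph V) (p : ℝ) (ω : Percolation.Config G) :
    Percolation.weight G p ω = p ^ (conf G ω).card * (1 - p) ^ (eg G \ conf G ω).card := by
  unfold Percolation.weight
  have h1 : ∏ e ∈ eg G, (if e ∈ conf G ω then p else 1 - p) =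
      ∏ e : G.edgeSet, if ω e then p else 1 - p := by
    rw [Finset.prod_subtype (eg G) (p := fun e => e ∈ G.edgeSet) (fun e => mem_eg)]
    refine Finset.prod_congr rfl fun e _ => ?_
    have : (e : Sym2 V) ∈ conf G ω ↔ ω e = true := by
      rw [mem_conf]
      exact ⟨fun ⟨_, h⟩ => h, fun h => ⟨e.2, h⟩⟩
    by_cases h : ω e = true
    · rw [if_pos (this.2 h), if_pos h]
    · rw [if_neg (fun h' => h (this.1 h')), if_neg h]
  rw [← h1, Finset.prod_ite, Finset.prod_const, Finset.prod_const]
  congr 3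
  · ext e
    simp only [Finset.mem_filter]
    exact ⟨fun h => h.2, fun h => ⟨conf_subset G ω h, h⟩⟩
  · ext e
    simp [Finset.mem_sdiff]

lemma expect_eq (G : SimpleGraph V) (p : ℝ) (F : Finset (Sym2 V) → ℝ) :
    Percolation.expect G p (fun ω => F (conf G ω)) = E p (eg G) F := by
  unfold Percolation.expect E
  refine Finset.sum_bij' (fun ω _ => conf G ω) (fun S _ => toConf G S)
    ?_ ?_ ?_ ?_ ?_
  · intro ω _
    exact Finset.mem_powerset.2 (conf_subset G ω)
  · intro S _
    exact Finset.mem_univ _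
  · intro ω _
    funext e
    have : (e : Sym2 V) ∈ conf G ω ↔ ω e = true := by
      rw [mem_conf]
      exact ⟨fun ⟨_, h⟩ => h, fun h => ⟨e.2, h⟩⟩
    by_cases h : ω e = true
    · simp [toConf, this, h]
    · simp [toConf, this, h]
  · intro S hS
    ext e
    rw [mem_conf]
    simp only [toConf, decide_eq_true_eq, exists_prop, and_iff_right_iff_imp]
    intro h
    exact mem_eg.1 (Finset.mem_powerset.1 hS h)
  · intro ω _
    rw [weight_eq]

lemma prob_eq (G : SimpleGraph V) (p : ℝ) (A : Percolation.Config G → Prop)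
    (F : Finset (Sym2 V) → Prop) (h : ∀ ω, A ω ↔ F (conf G ω)) :
    Percolation.prob G p A = E p (eg G) (fun S => ind (F S)) := by
  rw [← expect_eq]
  unfold Percolation.prob Percolation.expect
  refine Finset.sum_congr rfl fun ω _ => ?_
  show _ = _ * ind (F (conf G ω))
  by_cases hA : A ω
  · rw [if_pos hA, ind_pos ((h ω).1 hA), mul_one]
  · rw [if_neg hA, ind_neg (fun h' => hA ((h ω).2 h')), mul_zero]

lemma occ_eq (G : SimpleGraph V) (ω : Percolation.Config G) :
    Percolation.occupied G ω = H (conf G ω) := by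
  unfold Percolation.occupied H
  congr 1
  ext e
  simp [mem_conf]

lemma cluster_eq (G : SimpleGraph V) (ω : Percolation.Config G) (x : V) :
    Percolation.cluster G ω x = K (conf G ω) x := by
  ext y
  rw [mem_K]
  unfold Percolation.cluster R
  rw [occ_eq]
  simp

lemma chi_eq (G : SimpleGraph V) (x : V) (p : ℝ) :
    Percolation.chi G x p = EK p (eg G) (fun m => (m : ℝ)) x := by
  unfold Percolation.chi EK
  rw [← expect_eq]
  simp only [cluster_eq]

lemma tau_eq (G : SimpleGraph V) (p : ℝ) (x y : V) :
    Percolation.tau G p x y = tau p (eg G) x y := by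
  unfold Percolation.tau tau
  refine prob_eq G p _ (fun S => R S x y) fun ω => ?_
  rw [occ_eq]; rfl

lemma triangle_eq (G : SimpleGraph V) (p : ℝ) (x y : V) :
    Percolation.triangle G p x y = tri p (eg G) x y := by
  unfold Percolation.triangle tri
  simp only [tau_eq]

lemma Pgeq_eq (G : SimpleGraph V) (x : V) (p k : ℝ) :
    Percolation.Pgeq G x p k = E p (eg G) (fun S => ind (k ≤ ((K S x).card : ℝ))) := by
  unfold Percolation.Pgeq
  refine prob_eq G p _ (fun S => k ≤ ((K S x).card : ℝ)) fun ω => ?_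
  rw [cluster_eq]

lemma hloop_eg (G : SimpleGraph V) (a : V) : s(a, a) ∉ eg G := by
  rw [mem_eg, SimpleGraph.mem_edgeSet]
  exact G.irrefl

lemma hdeg_eg (G : SimpleGraph V) [DecidableRel G.Adj] (Ω : ℕ) (h : G.IsRegularOfDegree Ω) (a : V) :
    (Finset.univ.filter fun b => s(a, b) ∈ eg G).card = Ω := by
  rw [← h a, ← SimpleGraph.card_neighborFinset_eq_degree]
  congr 1
  ext b
  simp [mem_eg]

lemma R_map (σ : V ≃ V) (S : Finset (Sym2 V)) {x y : V} (h : R S x y) :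
    R (S.map (bondPerm σ).toEmbedding) (σ x) (σ y) := by
  refine R_induct (P := fun x => R (S.map (bondPerm σ).toEmbedding) (σ x) (σ y))
    (R_refl _ _) ?_ h
  intro a b hab _ _ ih
  refine R_trans (R_edge ?_) ih
  rw [Finset.mem_map]
  exact ⟨s(a, b), hab, rfl⟩

lemma hom_eg (G : SimpleGraph V) (h : Percolation.IsTransitive G) : Hom (eg G) := by
  intro p ψ x y
  obtain ⟨φ, rfl⟩ := h x y
  set σ : Equiv.Perm (Sym2 V) := bondPerm φ.toEquiv with hσ
  have hmap : (eg G).map σ.toEmbedding = eg G := by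
    ext e
    rw [Finset.mem_map_equiv, mem_eg, mem_eg]
    induction e with
    | _ a b =>
      have : σ.symm s(a, b) = s(φ.symm a, φ.symm b) := rfl
      rw [this, SimpleGraph.mem_edgeSet, SimpleGraph.mem_edgeSet]
      exact φ.symm.map_rel_iff
  have hE := E_perm p (eg G) σ hmap (fun S => ψ (K S (φ x)).card)
  unfold EK
  rw [← hE]
  refine E_congr fun S _ => ?_
  congr 1
  have : K (S.map σ.toEmbedding) (φ x) = (K S x).map φ.toEquiv.toEmbedding := by
    ext z
    rw [Finset.mem_map_equiv, mem_K, mem_K]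
    constructor
    · intro hz
      have h1 := R_map φ.toEquiv.symm _ hz
      have h2 : (S.map σ.toEmbedding).map (bondPerm φ.toEquiv.symm).toEmbedding = S := by
        rw [Finset.map_map]
        convert Finset.map_refl
        refine Function.Embedding.ext fun e => ?_
        exact σ.symm_apply_apply e
      rw [h2] at h1
      have h3 : φ.toEquiv.symm (φ x) = x := φ.symm_apply_apply x
      rwa [h3] at h1
    · intro hz
      have h1 := R_map φ.toEquiv _ hz
      rw [Equiv.apply_symm_apply] at h1
      exact h1
  rw [this, Finset.card_map]

end translate
end Perc

open Percolation in
/-- Theorem 1.3(i) (Critical window): the cluster size distribution inside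
the scaling window. -/
theorem critical_window_cluster_size_distribution :
    ∃ b₀ b₂ b₃ : ℝ, 0 < b₀ ∧ 0 < b₂ ∧ 0 < b₃ ∧
      ∀ lam Λ : ℝ, 0 < lam →
      ∃ b₁ : ℝ, 0 < b₁ ∧
        ∀ (V : Type) [Fintype V] [DecidableEq V]
          (G : SimpleGraph V) [DecidableRel G.Adj],
          G.Connected → IsTransitive G →
          ∀ Ω : ℕ, G.IsRegularOfDegree Ω →
          ∀ (x₀ : V),
          1 < lam * (Fintype.card V : ℝ) ^ ((1 : ℝ) / 3) →
          lam * (Fintype.card V : ℝ) ^ ((1 : ℝ) / 3) < (Fintype.card V : ℝ) →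
          b₀⁻¹ ≤ lam * (Fintype.card V : ℝ) ^ ((1 : ℝ) / 3) →
          ∀ pc : ℝ, 0 < pc → pc < 1 →
          chi G x₀ pc = lam * (Fintype.card V : ℝ) ^ ((1 : ℝ) / 3) →
          ∀ a₀ : ℝ, a₀ ≤ b₀ →
          (∀ x y : V, triangle G pc x y ≤ kron x y + a₀) →
          ∀ ε : ℝ, |ε| ≤ Λ * ((Fintype.card V : ℝ) ^ ((1 : ℝ) / 3))⁻¹ →
          ∀ p : ℝ, p = pc + (Ω : ℝ)⁻¹ * ε → 0 ≤ p → p ≤ 1 →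
          ∀ k : ℝ, 1 ≤ k → k ≤ b₁ * (Fintype.card V : ℝ) ^ ((2 : ℝ) / 3) →
            b₂ / Real.sqrt k ≤ Pgeq G x₀ p k ∧ Pgeq G x₀ p k ≤ b₃ / Real.sqrt k := by
  refine ⟨1 / 8, 28 / 65536, 92, by norm_num, by norm_num, by norm_num, ?_⟩
  intro lam Λ hlam
  set D : ℝ := lam⁻¹ + |Λ| + 1 with hD
  have hlam' : 0 < lam⁻¹ := by positivity
  have hD0 : 0 < D := by positivity
  refine ⟨((1000 * D)⁻¹) ^ 2, by positivity, ?_⟩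
  intro V _ _ G _ hconn htrans Ω hreg x₀ hc1 hc2 hc3 pc hpc0 hpc1 hchi a₀ ha₀ htri ε hε p hp hp0 hp1
    k hk1 hk2
  have : Nonempty V := ⟨x₀⟩
  set v : ℝ := (Fintype.card V : ℝ) ^ ((1 : ℝ) / 3) with hv
  have hcard : (1 : ℝ) < Fintype.card V := hc1.trans hc2
  have hv0 : 0 < v := by
    rw [hv]; exact Real.rpow_pos_of_pos (by linarith) _
  have hv2 : (Fintype.card V : ℝ) ^ ((2 : ℝ) / 3) = v ^ 2 := by
    rw [hv, ← Real.rpow_natCast, ← Real.rpow_mul (by linarith)]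
    norm_num
  have hΩ : 1 ≤ Ω := by
    have : Nontrivial V := Fintype.one_lt_card_iff_nontrivial.1 (by exact_mod_cast hcard)
    rw [← hreg x₀]
    exact hconn.preconnected.degree_pos_of_nontrivial x₀
  rw [Perc.Pgeq_eq]
  rw [hv2] at hk2
  have hsk : Real.sqrt k ≤ (1000 * D)⁻¹ * v := by
    rw [Real.sqrt_le_left (by positivity)]
    linarith [mul_pow (1000 * D)⁻¹ v 2]
  have htri' : ∀ x y : V, x ≠ y → Perc.tri pc (Perc.eg G) x y ≤ a₀ := by
    intro x y hxy
    have := htri x y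
    rw [Perc.triangle_eq] at this
    simpa [kron, hxy] using this
  refine Perc.core (Perc.hom_eg G htrans) (Perc.hloop_eg G) Ω hΩ (Perc.hdeg_eg G Ω hreg) x₀ pc
    hpc0.le hpc1.le (lam * v) (by rw [← Perc.chi_eq]; exact hchi) (by norm_num at hc3; linarith) a₀ ha₀
    htri' ε p hp hp0 k hk1 ?_
  have h1 : (lam * v)⁻¹ + 2 * |ε| ≤ 2 * D * v⁻¹ := by
    have h2 : |ε| ≤ |Λ| * v⁻¹ :=
      hε.trans (mul_le_mul_of_nonneg_right (le_abs_self Λ) (by positivity))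
    have hvi : 0 < v⁻¹ := by positivity
    rw [mul_inv, hD]
    have : 0 < lam⁻¹ * v⁻¹ := by positivity
    nlinarith
  calc Real.sqrt k * ((lam * v)⁻¹ + 2 * |ε|) ≤ ((1000 * D)⁻¹ * v) * (2 * D * v⁻¹) := by
        refine mul_le_mul hsk h1 (by positivity) (by positivity)
    _ = 1 / 500 := by field_simp; norm_num
    _ ≤ 1 / 500 := le_rfl
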